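/- Let [u,w] be a Bruhat interval in a Weyl group W. If the dual poset [u,w]* is isomorphic (as a poset) to some lower Bruhat interval [e,x] in a Weyl group W' (possibly of a different type), then [u,w] is rationally smooth, i.e. deg_{y,w}(y) = ℓ(w) − ℓ(y) for all y ∈ [u,w]. -/

import Mathlib

namespace Paper

/-! ### Bruhat order on a Coxeter group -/

variable {B W : Type*} [Group W] {M : CoxeterMatrix B}

/-- One step in the Bruhat order: multiply on the left by a reflection,
increasing the length. -/
def BruhatStep (cs : CoxeterSystem M W) (a b : W) : Prop :=
  ∃ t : W, cs.IsReflection t ∧ b = t * a ∧ cs.length a < cs.length b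

/-- The Bruhat order on a Coxeter group. -/
def BruhatLE (cs : CoxeterSystem M W) : W → W → Prop :=
  Relation.ReflTransGen (BruhatStep cs)

theorem BruhatLE.length_le {cs : CoxeterSystem M W} {a b : W} (h : BruhatLE cs a b) :
    cs.length a ≤ cs.length b := by
  induction h with
  | refl => exact le_rfl
  | tail _ h ih => obtain ⟨t, -, -, hlt⟩ := h; exact ih.trans hlt.le

theorem BruhatLE.length_lt {cs : CoxeterSystem M W} {a b : W} (h : BruhatLE cs a b)
    (hne : a ≠ b) : cs.length a < cs.length b := by
  rcases Relation.ReflTransGen.cases_head h with h' | ⟨c, hc, h'⟩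
  · exact absurd h' hne
  · obtain ⟨t, -, -, hlt⟩ := hc
    exact lt_of_lt_of_le hlt (BruhatLE.length_le h')

theorem BruhatLE.antisymm {cs : CoxeterSystem M W} {a b : W} (h1 : BruhatLE cs a b)
    (h2 : BruhatLE cs b a) : a = b := by
  by_contra hne
  exact absurd (BruhatLE.length_lt h1 hne) (not_lt.mpr (BruhatLE.length_le h2))

/-- The Bruhat interval `[u,w]`, as a type. -/
abbrev BruhatInterval (cs : CoxeterSystem M W) (u w : W) : Type _ :=
  {y : W // BruhatLE cs u y ∧ BruhatLE cs y w}

/-- The Bruhat interval `[u,w]` is a poset under the Bruhat order. -/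
instance (cs : CoxeterSystem M W) (u w : W) : PartialOrder (BruhatInterval cs u w) where
  le a b := BruhatLE cs a.1 b.1
  le_refl _ := Relation.ReflTransGen.refl
  le_trans _ _ _ := Relation.ReflTransGen.trans
  le_antisymm _ _ h1 h2 := Subtype.ext (BruhatLE.antisymm h1 h2)

/-- A principal order ideal `{v : v ≤ x}` of the Bruhat order, as a type. -/
abbrev BruhatIdeal (cs : CoxeterSystem M W) (x : W) : Type _ :=
  {v : W // BruhatLE cs v x}

/-- A principal order ideal of the Bruhat order is a poset under the Bruhat order. -/
instance (cs : CoxeterSystem M W) (x : W) : PartialOrder (BruhatIdeal cs x) where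
  le a b := BruhatLE cs a.1 b.1
  le_refl _ := Relation.ReflTransGen.refl
  le_trans _ _ _ := Relation.ReflTransGen.trans
  le_antisymm _ _ h1 h2 := Subtype.ext (BruhatLE.antisymm h1 h2)

/-! ### Posets: matchings, special matchings and zircons -/

/-- A matching of a poset: an involution matching each element with an element
covering it or covered by it. -/
def IsMatching {α : Type*} [PartialOrder α] (f : α → α) : Prop :=
  Function.Involutive f ∧ ∀ x : α, f x ⋖ x ∨ x ⋖ f x

/-- A special matching of a poset. -/
def IsSpecialMatching {α : Type*} [PartialOrder α] (f : α → α) : Prop :=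
  IsMatching f ∧ ∀ x y : α, x ⋖ y → f x = y ∨ f x < f y

/-- A zircon: a poset in which the principal order ideal of every non-minimal element is
finite and has a special matching. -/
def IsZircon (α : Type*) [PartialOrder α] : Prop :=
  ∀ x : α, (∃ y : α, y < x) →
    ({v : α | v ≤ x}.Finite ∧
      ∃ f : {v : α // v ≤ x} → {v : α // v ≤ x}, IsSpecialMatching f)

/-- The degree of `v` in the Bruhat graph of the interval `[u,w]`: the number of `y ∈ [u,w]`
such that `v⁻¹ * y` is a reflection. -/
noncomputable def bruhatDeg (cs : CoxeterSystem M W) (u w v : W) : ℕ :=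
  Nat.card {y : W // (BruhatLE cs u y ∧ BruhatLE cs y w) ∧ cs.IsReflection (v⁻¹ * y)}

/-- A Bruhat interval `[u,w]` is rationally smooth if `deg_{y,w}(y) = ℓ(w) - ℓ(y)` for all
`y ∈ [u,w]` (Carrell–Peterson). -/
def RationallySmooth (cs : CoxeterSystem M W) (u w : W) : Prop :=
  ∀ y : W, BruhatLE cs u y → BruhatLE cs y w →
    bruhatDeg cs y w y = cs.length w - cs.length y


/-! ### Root realizations of Coxeter groups -/

/-- A reflection representation of a Coxeter group, with a root for each simple reflection, an
invariant form, and a linear functional whose sign separates the positive roots from the negative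
ones. -/
structure RootRep (cs : CoxeterSystem M W) (V : Type*) [AddCommGroup V] [Module ℝ V] where
  /-- The representation. -/
  ρ : W →* Module.End ℝ V
  /-- The simple roots. -/
  root : B → V
  /-- The invariant bilinear form, for which roots have square length two. -/
  form : V →ₗ[ℝ] V →ₗ[ℝ] ℝ
  /-- The height functional. -/
  height : V →ₗ[ℝ] ℝ
  form_comm : ∀ x y, form x y = form y x
  form_map : ∀ w x y, form (ρ w x) (ρ w y) = form x y
  form_root : ∀ i, form (root i) (root i) = 2
  map_simple : ∀ i x, ρ (cs.simple i) x = x - form (root i) x • root i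
  height_pos : ∀ w i, ¬ cs.IsRightDescent w i → 0 < height (ρ w (root i))
  height_simple_pos : ∀ w i j, 0 < height (ρ w (root i)) → ρ w (root i) ≠ root j →
    0 < height (ρ (cs.simple j) (ρ w (root i)))

section Geometric

open CoxeterSystem Finsupp

/-- The bilinear form of the geometric representation, normalized so that simple roots have
square length two. -/
noncomputable def geomForm (M : CoxeterMatrix B) : (B →₀ ℝ) →ₗ[ℝ] (B →₀ ℝ) →ₗ[ℝ] ℝ :=
  linearCombination ℝ fun i => linearCombination ℝ fun j => -2 * Real.cos (Real.pi / M i j)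

theorem geomForm_single (M : CoxeterMatrix B) (i j : B) :
    geomForm M (single i 1) (single j 1) = -2 * Real.cos (Real.pi / M i j) := by
  simp [geomForm]

theorem geomForm_self (M : CoxeterMatrix B) (i : B) :
    geomForm M (single i 1) (single i 1) = 2 := by
  simp [geomForm_single]

theorem geomForm_comm (M : CoxeterMatrix B) (x y : B →₀ ℝ) :
    geomForm M x y = geomForm M y x := by
  have : geomForm M = (geomForm M).flip := by
    ext i j
    simp only [LinearMap.coe_comp, Function.comp_apply, lsingle_apply, LinearMap.flip_apply]
    rw [geomForm_single, geomForm_single, M.symmetric]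
  conv_lhs => rw [this]
  rfl

/-- The simple reflections of the geometric representation. -/
noncomputable def geomSimple (M : CoxeterMatrix B) (i : B) : Module.End ℝ (B →₀ ℝ) :=
  LinearMap.id - (geomForm M (single i 1)).smulRight (single i 1)

theorem geomSimple_apply (M : CoxeterMatrix B) (i : B) (x : B →₀ ℝ) :
    geomSimple M i x = x - geomForm M (single i 1) x • single i 1 := rfl

theorem geomForm_geomSimple (M : CoxeterMatrix B) (i : B) (x y : B →₀ ℝ) :
    geomForm M (geomSimple M i x) (geomSimple M i y) = geomForm M x y := by
  simp only [geomSimple_apply, map_sub, LinearMap.sub_apply, map_smul, LinearMap.smul_apply,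
    geomForm_self, smul_eq_mul, geomForm_comm M x (single i 1)]
  ring

theorem four_mul_cos_sq {m : ℕ} (hm : m ∈ ({2, 3, 4, 6} : Set ℕ)) :
    (-2 * Real.cos (Real.pi / m)) ^ 2 = if m = 2 then 0 else if m = 3 then 1 else
      if m = 4 then 2 else 3 := by
  have h2 : Real.sqrt 2 ^ 2 = 2 := Real.sq_sqrt (by norm_num)
  have h3 : Real.sqrt 3 ^ 2 = 3 := Real.sq_sqrt (by norm_num)
  rcases hm with rfl | rfl | rfl | rfl
  · simp
  · simp
  · norm_num [Real.cos_pi_div_four]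
    linarith
  · norm_num [Real.cos_pi_div_six]
    linarith

/-- The product of two simple reflections has the order prescribed by the Coxeter matrix. -/
theorem isLiftable_geomSimple
    (hM : ∀ i j : B, i ≠ j → M i j ∈ ({2, 3, 4, 6} : Set ℕ)) :
    M.IsLiftable (geomSimple M) := by
  intro i j
  rcases eq_or_ne i j with rfl | hij
  · rw [M.diagonal, pow_one]
    refine LinearMap.ext fun x => ?_
    simp only [Module.End.mul_apply, geomSimple_apply, map_sub, map_smul, geomForm_self,
      Module.End.one_apply]
    module
  have hsq := four_mul_cos_sq (hM i j hij)
  rw [← geomForm_single] at hsq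
  have hc : geomForm M (single j 1) (single i 1) = geomForm M (single i 1) (single j 1) :=
    geomForm_comm _ _ _
  generalize hcd : geomForm M (single i 1) (single j 1) = c at hsq hc
  have h1 : ∀ x, (geomSimple M i * geomSimple M j) x =
      x + (c * geomForm M (single j 1) x - geomForm M (single i 1) x) • single i (1 : ℝ)
        - geomForm M (single j 1) x • single j (1 : ℝ) := by
    intro x
    simp only [Module.End.mul_apply, geomSimple_apply, map_sub, map_smul, hcd]
    module
  generalize geomSimple M i * geomSimple M j = A at h1 ⊢
  have hi : ∀ x, geomForm M (single i 1) (A x) =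
      c * geomForm M (single j 1) x - geomForm M (single i 1) x := by
    intro x
    simp only [h1, map_add, map_sub, map_smul, hcd, geomForm_self, smul_eq_mul]
    ring
  have hj : ∀ x, geomForm M (single j 1) (A x) =
      (c ^ 2 - 1) * geomForm M (single j 1) x - c * geomForm M (single i 1) x := by
    intro x
    simp only [h1, map_add, map_sub, map_smul, hc, geomForm_self, smul_eq_mul]
    ring
  have h3 : ∀ x, A (A (A x)) = (c ^ 2 - 1) • A (A x) - (c ^ 2 - 1) • A x + x := by
    intro x
    rw [h1 (A (A x))]
    simp only [hi, hj]
    rw [h1 (A x), hi, hj, h1 x]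
    module
  refine LinearMap.ext fun x => ?_
  rcases hM i j hij with h | h | h | (h : M i j = 6) <;> rw [h] at hsq ⊢ <;>
    simp only [pow_succ _ 5, pow_succ _ 4, pow_succ _ 3, pow_succ _ 2, pow_two A,
      Module.End.mul_apply, Module.End.one_apply]
  · have hsq : c = 0 := by simpa using hsq
    rw [h1 (A x), hi, hj, h1 x, hsq]
    module
  · have hsq : c ^ 2 = 1 := hsq.trans (by norm_num)
    simp only [pow_succ, pow_zero, one_mul, h3]
    rw [← pow_two, hsq]
    module
  · have hsq : c ^ 2 = 2 := hsq.trans (by norm_num)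
    simp only [h3, hsq, map_add, map_sub, map_smul]
    module
  · have hsq : c ^ 2 = 3 := hsq.trans (by norm_num)
    simp only [h3, hsq, map_add, map_sub, map_smul]
    module

/-- The geometric representation. -/
noncomputable def geomRep (cs : CoxeterSystem M W)
    (hM : ∀ i j : B, i ≠ j → M i j ∈ ({2, 3, 4, 6} : Set ℕ)) :
    W →* Module.End ℝ (B →₀ ℝ) :=
  cs.lift ⟨geomSimple M, isLiftable_geomSimple hM⟩

theorem geomRep_simple (cs : CoxeterSystem M W)
    (hM : ∀ i j : B, i ≠ j → M i j ∈ ({2, 3, 4, 6} : Set ℕ)) (i : B) :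
    geomRep cs hM (cs.simple i) = geomSimple M i :=
  cs.lift_apply_simple _ i

theorem geomForm_geomRep (cs : CoxeterSystem M W)
    (hM : ∀ i j : B, i ≠ j → M i j ∈ ({2, 3, 4, 6} : Set ℕ)) (w : W) (x y : B →₀ ℝ) :
    geomForm M (geomRep cs hM w x) (geomRep cs hM w y) = geomForm M x y := by
  induction w using cs.simple_induction_left generalizing x y with
  | one => simp
  | mul_simple_left w i ih =>
    rw [map_mul, geomRep_simple, Module.End.mul_apply, Module.End.mul_apply,
      geomForm_geomSimple, ih]

theorem geomRep_alternatingWord (cs : CoxeterSystem M W)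
    (hM : ∀ i j : B, i ≠ j → M i j ∈ ({2, 3, 4, 6} : Set ℕ)) (i j : B) (k : ℕ) :
    geomRep cs hM (cs.wordProd (alternatingWord i j k))
        (Real.sin (Real.pi / M i j) • single i 1) =
      Real.sin ((k + 1 : ℕ) * (Real.pi / M i j)) • single (if Even k then i else j) (1 : ℝ) +
        Real.sin (k * (Real.pi / M i j)) • single (if Even k then j else i) (1 : ℝ) := by
  have hij := geomForm_single M i j
  have hji := geomForm_comm M (single i 1) (single j 1) ▸ hij
  generalize Real.pi / M i j = θ at *
  have key : ∀ k : ℕ, Real.sin ((k + 1 + 1 : ℕ) * θ) =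
      2 * Real.cos θ * Real.sin ((k + 1 : ℕ) * θ) - Real.sin (k * θ) := by
    intro k
    have h1 : ((k + 1 + 1 : ℕ) : ℝ) * θ = (k + 1 : ℕ) * θ + θ := by push_cast; ring
    have h2 : (k : ℝ) * θ = (k + 1 : ℕ) * θ - θ := by push_cast; ring
    rw [h1, h2, Real.sin_add, Real.sin_sub]
    ring
  induction k with
  | zero => simp [alternatingWord]
  | succ k ih =>
    rw [alternatingWord_succ', cs.wordProd_cons, map_mul, Module.End.mul_apply, ih,
      geomRep_simple, key]
    by_cases hk : Even k
    · simp only [hk, Nat.even_add_one, not_true, if_true, if_false, geomSimple_apply, map_add,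
        map_smul, geomForm_self, hji]
      module
    · simp only [hk, Nat.even_add_one, not_false_eq_true, if_true, if_false, geomSimple_apply,
        map_add, map_smul, geomForm_self, hij]
      module

theorem exists_parabolic_decomposition (cs : CoxeterSystem M W) {w : W} {i j : B}
    (hi : ¬ cs.IsRightDescent w i) (hj : cs.IsRightDescent w j) (hij : M i j ≠ 0) :
    ∃ v k, w = v * cs.wordProd (alternatingWord i j k) ∧ k + 1 ≤ M i j ∧
      cs.length v < cs.length w ∧ ¬ cs.IsRightDescent v i ∧ ¬ cs.IsRightDescent v j := by
  classical
  let Q : ℕ → Prop := fun k =>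
    ∃ v, w = v * cs.wordProd (alternatingWord i j k) ∧ cs.length v + k = cs.length w
  have hQ1 : Q 1 := ⟨w * cs.simple j, by simp [alternatingWord], cs.isRightDescent_iff.1 hj⟩
  have hle : ∀ k, Q k → k ≤ cs.length w := fun k ⟨v, _, h⟩ => by omega
  set k := Nat.findGreatest Q (cs.length w)
  have hk : Q k := Nat.findGreatest_spec (hle 1 hQ1) hQ1
  have hk1 : 1 ≤ k := Nat.le_findGreatest (hle 1 hQ1) hQ1
  have hmax : ¬ Q (k + 1) := fun h => by
    have := Nat.le_findGreatest (hle _ h) h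
    omega
  obtain ⟨v, hv, hl⟩ := hk
  have hnext : ¬ cs.IsRightDescent v (if Even k then j else i) := fun h => by
    refine hmax ⟨v * cs.simple (if Even k then j else i), ?_, ?_⟩
    · rw [alternatingWord_succ', cs.wordProd_cons, mul_assoc, cs.simple_mul_simple_cancel_left, hv]
    · have := cs.isRightDescent_iff.1 h
      omega
  have hprev : ¬ cs.IsRightDescent v (if Even k then i else j) := fun h => by
    obtain ⟨l, hkl⟩ : ∃ l, k = l + 1 := ⟨k - 1, by omega⟩
    have h1 := cs.isRightDescent_iff.1 h
    rw [hkl, alternatingWord_succ', cs.wordProd_cons, ← mul_assoc] at hv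
    have h2 : (if Even l then j else i) = if Even k then i else j := by
      rw [hkl]
      by_cases hl : Even l <;> simp [Nat.even_add_one, hl]
    rw [h2] at hv
    have h3 := cs.length_mul_le (v * cs.simple (if Even k then i else j))
      (cs.wordProd (alternatingWord i j l))
    have h4 := cs.length_wordProd_le (alternatingWord i j l)
    rw [← hv] at h3
    rw [length_alternatingWord] at h4
    omega
  refine ⟨v, k, hv, ?_, by omega, ?_, ?_⟩
  · by_contra hlt
    have h1 : w * cs.simple i = v * cs.wordProd (alternatingWord j i (k + 1)) := by
      rw [alternatingWord_succ, cs.wordProd_concat, ← mul_assoc, ← hv]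
    have h2 := cs.not_isRightDescent_iff.1 hi
    have h3 := cs.length_mul_le v (cs.wordProd (alternatingWord j i (k + 1)))
    have h4 := cs.length_wordProd_le (alternatingWord j i (k + 1))
    rw [← h1] at h3
    refine cs.not_isReduced_alternatingWord j i (m := k + 1) (by rwa [M.symmetric])
      (by rw [M.symmetric]; omega) ?_
    unfold CoxeterSystem.IsReduced
    rw [length_alternatingWord] at h4 ⊢
    omega
  · by_cases h : Even k
    · simpa [h] using hprev
    · simpa [h] using hnext
  · by_cases h : Even k
    · simpa [h] using hnext
    · simpa [h] using hprev

theorem geomRep_nonneg (cs : CoxeterSystem M W)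
    (hM : ∀ i j : B, i ≠ j → M i j ∈ ({2, 3, 4, 6} : Set ℕ)) (w : W) (i : B)
    (hi : ¬ cs.IsRightDescent w i) (b : B) : 0 ≤ geomRep cs hM w (single i 1) b := by
  induction hn : cs.length w using Nat.strong_induction_on generalizing w i with
  | _ n ih =>
    subst hn
    by_cases hw : w = 1
    · subst hw
      classical
      simp only [map_one, Module.End.one_apply, single_apply]
      split_ifs <;> norm_num
    obtain ⟨j, hj⟩ := cs.exists_rightDescent_of_ne_one hw
    have hij : i ≠ j := fun h => hi (h ▸ hj)
    have hm : 2 ≤ M i j := by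
      rcases hM i j hij with h | h | h | (h : M i j = 6) <;> omega
    obtain ⟨v, k, hv, hk, hlt, hvi, hvj⟩ := exists_parabolic_decomposition cs hi hj (by omega)
    have hpos := ih _ hlt v i hvi rfl
    have hpos' := ih _ hlt v j hvj rfl
    have hm0 : (0 : ℝ) < M i j := by exact_mod_cast (by omega : 0 < M i j)
    have hsin : 0 < Real.sin (Real.pi / M i j) :=
      Real.sin_pos_of_pos_of_lt_pi (by positivity)
        (div_lt_self Real.pi_pos (by exact_mod_cast (by omega : 1 < M i j)))
    have hsin' : ∀ l : ℕ, l ≤ M i j → 0 ≤ Real.sin (l * (Real.pi / M i j)) := by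
      intro l hl
      refine Real.sin_nonneg_of_nonneg_of_le_pi (by positivity) ?_
      rw [mul_div_assoc', div_le_iff₀ hm0, mul_comm]
      gcongr
    have h : (Real.sin (Real.pi / M i j)) * geomRep cs hM w (single i 1) b =
        Real.sin ((k + 1 : ℕ) * (Real.pi / M i j)) *
          geomRep cs hM v (single (if Even k then i else j) 1) b +
        Real.sin (k * (Real.pi / M i j)) *
          geomRep cs hM v (single (if Even k then j else i) 1) b := by
      have h := congrArg (fun x => geomRep cs hM v x b) (geomRep_alternatingWord cs hM i j k)
      simp only [← Module.End.mul_apply, ← map_mul, ← hv] at h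
      simpa only [map_add, map_smul, Finsupp.add_apply, Finsupp.smul_apply, smul_eq_mul] using h
    refine nonneg_of_mul_nonneg_right (h ▸ ?_) hsin
    have h1 := hsin' (k + 1) hk
    have h2 := hsin' k (by omega)
    refine add_nonneg (mul_nonneg h1 ?_) (mul_nonneg h2 ?_) <;> split_ifs <;> assumption

theorem geomRep_nonpos (cs : CoxeterSystem M W)
    (hM : ∀ i j : B, i ≠ j → M i j ∈ ({2, 3, 4, 6} : Set ℕ)) (w : W) (i : B)
    (hi : cs.IsRightDescent w i) (b : B) : geomRep cs hM w (single i 1) b ≤ 0 := by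
  have h := geomRep_nonneg cs hM (w * cs.simple i) i
    (fun h => cs.isRightDescent_iff_not_isRightDescent_mul.1 hi h) b
  rw [map_mul, geomRep_simple, Module.End.mul_apply, geomSimple_apply, geomForm_self, map_sub,
    map_smul, Finsupp.sub_apply, Finsupp.smul_apply, smul_eq_mul] at h
  linarith

theorem geomHeight_nonneg {x : B →₀ ℝ} (hx : ∀ b, 0 ≤ x b) :
    0 ≤ linearCombination ℝ (fun _ => (1 : ℝ)) x := by
  rw [linearCombination_apply]
  exact Finsupp.sum_nonneg fun b _ => by simpa using hx b

theorem geomHeight_pos {x : B →₀ ℝ} (hx : ∀ b, 0 ≤ x b) (h0 : x ≠ 0) :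
    0 < linearCombination ℝ (fun _ => (1 : ℝ)) x := by
  rw [linearCombination_apply]
  exact Finset.sum_pos (fun b hb => by
    simpa using lt_of_le_of_ne (hx b) (Ne.symm (mem_support_iff.1 hb)))
    (support_nonempty_iff.2 h0)

/-- The geometric representation of a Coxeter group, with the simple roots as a basis. -/
noncomputable def geomRootRep (cs : CoxeterSystem M W)
    (hM : ∀ i j : B, i ≠ j → M i j ∈ ({2, 3, 4, 6} : Set ℕ)) : RootRep cs (B →₀ ℝ) where
  ρ := geomRep cs hM
  root i := single i 1
  form := geomForm M
  height := linearCombination ℝ fun _ => (1 : ℝ)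
  form_comm := geomForm_comm M
  form_map := geomForm_geomRep cs hM
  form_root := geomForm_self M
  map_simple i x := by rw [geomRep_simple, geomSimple_apply]
  height_pos w i hi := by
    refine geomHeight_pos (geomRep_nonneg cs hM w i hi) fun h => ?_
    have := geomForm_geomRep cs hM w (single i 1) (single i 1)
    simp [h, geomForm_self] at this
  height_simple_pos w i j hpos hne := by
    have hform := geomForm_geomRep cs hM w (single i 1) (single i 1)
    have hi : ¬ cs.IsRightDescent w i := fun hi => by
      have := geomHeight_nonneg (x := -geomRep cs hM w (single i 1)) fun b => by
        simpa using geomRep_nonpos cs hM w i hi b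
      rw [map_neg] at this
      linarith
    have hb := geomRep_nonneg cs hM w i hi
    rw [← Module.End.mul_apply, ← map_mul]
    have hnd : ¬ cs.IsRightDescent (cs.simple j * w) i := fun hd => by
      have hb' := geomRep_nonpos cs hM _ i hd
      simp only [map_mul, Module.End.mul_apply, geomRep_simple, geomSimple_apply] at hb'
      generalize geomRep cs hM w (single i 1) = β at *
      have hβ : β = single j (β j) := by
        classical
        ext b
        rw [single_apply]
        split_ifs with h
        · rw [h]
        · have := hb' b
          simp only [Finsupp.sub_apply, Finsupp.smul_apply, single_apply, if_neg h,
            smul_zero, sub_zero] at this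
          exact le_antisymm this (hb b)
      have h1 : β = β j • single j 1 := by rw [smul_single_one]; exact hβ
      rw [h1, map_smul, map_smul, LinearMap.smul_apply, geomForm_self, geomForm_self] at hform
      simp only [smul_eq_mul] at hform
      have h2 := hb j
      have h3 : β j = 1 := by nlinarith
      exact hne (by rw [hβ, h3])
    refine geomHeight_pos (geomRep_nonneg cs hM _ i hnd) fun h => ?_
    have := geomForm_geomRep cs hM (cs.simple j * w) (single i 1) (single i 1)
    rw [h, map_zero, geomForm_self] at this
    norm_num at this

end Geometric

namespace RootRep

variable {cs : CoxeterSystem M W} {V : Type*} [AddCommGroup V] [Module ℝ V] (R : RootRep cs V)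

/-- The relation between a reflection and either of its two roots. -/
def IsRootOf (t : W) (γ : V) : Prop :=
  ∃ w i, t = w * cs.simple i * w⁻¹ ∧ γ = R.ρ w (R.root i)

/-- The set of positive roots. -/
def posRoots : Set V := {γ | (∃ t, R.IsRootOf t γ) ∧ 0 < R.height γ}

/-- The positive roots in `P` sent to negative roots by `x`. -/
def inversions (P : Submodule ℝ V) (x : W) : Set V :=
  {γ | γ ∈ R.posRoots ∧ γ ∈ P ∧ R.height (R.ρ x γ) < 0}

/-- The number of inversions of `x` in `P`. -/
noncomputable def level (P : Submodule ℝ V) (x : W) : ℕ := (R.inversions P x).ncard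

theorem ρ_inv_apply (w : W) (x : V) : R.ρ w⁻¹ (R.ρ w x) = x := by
  rw [← Module.End.mul_apply, ← map_mul, inv_mul_cancel, map_one, Module.End.one_apply]

theorem ρ_apply_inv (w : W) (x : V) : R.ρ w (R.ρ w⁻¹ x) = x := by
  simp

theorem ρ_mul_apply (v w : W) (x : V) : R.ρ (v * w) x = R.ρ v (R.ρ w x) := by
  rw [map_mul, Module.End.mul_apply]

theorem ρ_injective (w : W) : Function.Injective (R.ρ w) :=
  Function.LeftInverse.injective (R.ρ_inv_apply w)

theorem simple_root (i : B) : R.ρ (cs.simple i) (R.root i) = -R.root i := by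
  rw [R.map_simple, R.form_root]
  module

theorem isRootOf_simple (i : B) : R.IsRootOf (cs.simple i) (R.root i) := ⟨1, i, by simp, by simp⟩

theorem height_root (i : B) : 0 < R.height (R.root i) := by
  simpa using R.height_pos 1 i (by simp [CoxeterSystem.IsRightDescent])

variable {R}

namespace IsRootOf

variable {s t : W} {γ δ : V}

theorem isReflection (h : R.IsRootOf t γ) : cs.IsReflection t := by
  obtain ⟨w, i, rfl, -⟩ := h
  exact ⟨w, i, rfl⟩

theorem conj (h : R.IsRootOf t γ) (v : W) : R.IsRootOf (v * t * v⁻¹) (R.ρ v γ) := by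
  obtain ⟨w, i, rfl, rfl⟩ := h
  exact ⟨v * w, i, by group, (R.ρ_mul_apply v w _).symm⟩

theorem mul_self (h : R.IsRootOf t γ) : t * t = 1 := h.isReflection.mul_self

theorem inv_eq (h : R.IsRootOf t γ) : t⁻¹ = t := h.isReflection.inv

theorem neg (h : R.IsRootOf t γ) : R.IsRootOf t (-γ) := by
  obtain ⟨w, i, rfl, rfl⟩ := h
  refine ⟨w * cs.simple i, i, by simp [mul_assoc], ?_⟩
  rw [R.ρ_mul_apply, simple_root, map_neg]

theorem form_self (h : R.IsRootOf t γ) : R.form γ γ = 2 := by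
  obtain ⟨w, i, rfl, rfl⟩ := h
  rw [R.form_map, R.form_root]

theorem apply (h : R.IsRootOf t γ) (x : V) : R.ρ t x = x - R.form γ x • γ := by
  obtain ⟨w, i, rfl, rfl⟩ := h
  rw [R.ρ_mul_apply, R.ρ_mul_apply, R.map_simple, map_sub, map_smul, R.ρ_apply_inv,
    ← R.form_map w, R.ρ_apply_inv]

theorem apply_self (h : R.IsRootOf t γ) : R.ρ t γ = -γ := by
  rw [h.apply, h.form_self]
  module

theorem apply_apply (h : R.IsRootOf t γ) (x : V) : R.ρ t (R.ρ t x) = x := by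
  rw [← R.ρ_mul_apply, h.mul_self, map_one, Module.End.one_apply]

theorem apply_mem (h : R.IsRootOf t γ) {P : Submodule ℝ V} (hγ : γ ∈ P) {x : V} (hx : x ∈ P) :
    R.ρ t x ∈ P := by
  rw [h.apply]
  exact P.sub_mem hx (P.smul_mem _ hγ)

theorem height_ne_zero (h : R.IsRootOf t γ) : R.height γ ≠ 0 := by
  obtain ⟨w, i, rfl, rfl⟩ := h
  by_cases hi : cs.IsRightDescent w i
  · have := R.height_pos (w * cs.simple i) i
      (cs.isRightDescent_iff_not_isRightDescent_mul.1 hi)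
    rw [R.ρ_mul_apply, simple_root, map_neg, map_neg] at this
    linarith
  · exact (R.height_pos w i hi).ne'

theorem eq_or_eq_neg (h : R.IsRootOf t γ) (h' : R.IsRootOf s δ) {c : ℝ} (hc : δ = c • γ) :
    δ = γ ∨ δ = -γ := by
  have h1 := h'.form_self
  rw [hc, map_smul, map_smul, LinearMap.smul_apply, h.form_self] at h1
  simp only [smul_eq_mul] at h1
  have h2 : (c - 1) * (c + 1) = 0 := by linarith
  rcases mul_eq_zero.1 h2 with h | h
  · left; rw [hc, sub_eq_zero.1 h, one_smul]
  · right; rw [hc, eq_neg_of_add_eq_zero_left h, neg_one_smul]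

theorem eq_or_eq_neg_of_reflection (h : R.IsRootOf t γ) (h' : R.IsRootOf t δ) :
    δ = γ ∨ δ = -γ := by
  refine h.eq_or_eq_neg h' (c := R.form γ δ / 2) ?_
  have h1 := h.apply δ
  rw [h'.apply_self] at h1
  have h2 : (2 : ℝ) • δ = R.form γ δ • γ := by
    linear_combination (norm := module) (-1 : ℝ) • h1
  rw [div_eq_inv_mul, mul_smul, ← h2, smul_smul]
  norm_num

end IsRootOf

variable (R)

theorem ρ_faithful {w : W} (h : R.ρ w = 1) : w = 1 := by
  by_contra hw
  obtain ⟨i, hi⟩ := cs.exists_rightDescent_of_ne_one hw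
  have := R.height_pos (w * cs.simple i) i (cs.isRightDescent_iff_not_isRightDescent_mul.1 hi)
  rw [R.ρ_mul_apply, simple_root, h, Module.End.one_apply, map_neg] at this
  linarith [R.height_root i]

theorem exists_isRootOf {t : W} (h : cs.IsReflection t) :
    ∃ γ, R.IsRootOf t γ ∧ 0 < R.height γ := by
  obtain ⟨w, i, rfl⟩ := h
  have h : R.IsRootOf (w * cs.simple i * w⁻¹) (R.ρ w (R.root i)) := ⟨w, i, rfl, rfl⟩
  rcases h.height_ne_zero.lt_or_gt with h' | h'
  · exact ⟨_, h.neg, by rw [map_neg]; linarith⟩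
  · exact ⟨_, h, h'⟩

variable {R}

theorem IsRootOf.reflection_unique {s t : W} {γ : V} (h : R.IsRootOf t γ) (h' : R.IsRootOf s γ) :
    t = s := by
  refine inv_mul_eq_one.1 (R.ρ_faithful (LinearMap.ext fun x => ?_))
  rw [R.ρ_mul_apply, h.inv_eq, h'.apply, ← h.apply, h.apply_apply, Module.End.one_apply]

theorem finite_posRoots [Finite W] : R.posRoots.Finite := by
  choose f hf using fun γ : R.posRoots => γ.2.1
  refine Set.finite_coe_iff.1 (Finite.of_injective f fun γ δ h => ?_)
  have h1 := hf γ
  rw [h] at h1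
  rcases h1.eq_or_eq_neg_of_reflection (hf δ) with h2 | h2
  · exact Subtype.ext h2.symm
  · have h3 := γ.2.2
    have h4 := δ.2.2
    rw [h2, map_neg] at h4
    linarith

theorem finite_inversions [Finite W] (P : Submodule ℝ V) (x : W) : (R.inversions P x).Finite :=
  finite_posRoots.subset fun _ h => h.1

theorem IsRootOf.level_lt [Finite W] {P : Submodule ℝ V} {t x : W} {γ : V} (h : R.IsRootOf t γ)
    (hP : γ ∈ P) (hγ : 0 < R.height γ) (hx : 0 < R.height (R.ρ x γ)) :
    R.level P x < R.level P (x * t) := by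
  classical
  have hmem : γ ∈ R.inversions P (x * t) := by
    refine ⟨⟨⟨t, h⟩, hγ⟩, hP, ?_⟩
    rw [R.ρ_mul_apply, h.apply_self, map_neg, map_neg]
    linarith
  refine lt_of_le_of_lt ?_ (Set.ncard_sdiff_singleton_lt_of_mem hmem (finite_inversions _ _))
  refine Set.ncard_le_ncard_of_injOn (fun δ => if 0 < R.height (R.ρ t δ) then R.ρ t δ else δ)
    ?_ ?_ ((finite_inversions _ _).subset Set.sdiff_subset)
  · rintro δ ⟨⟨⟨s, hs⟩, hδ⟩, hδP, hδx⟩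
    split_ifs with h1
    · refine ⟨⟨⟨⟨_, hs.conj t⟩, h1⟩, h.apply_mem hP hδP, ?_⟩, fun h2 => ?_⟩
      · rwa [R.ρ_mul_apply, h.apply_apply]
      · have h3 := congrArg (R.ρ t) (Set.mem_singleton_iff.1 h2)
        rw [h.apply_apply, h.apply_self] at h3
        rw [h3, map_neg] at hδ
        linarith
    · refine ⟨⟨⟨⟨s, hs⟩, hδ⟩, hδP, ?_⟩, fun h2 => ?_⟩
      · rw [h.apply, map_sub, map_smul, smul_eq_mul] at h1
        rw [R.ρ_mul_apply, h.apply, map_sub, map_sub, map_smul, map_smul, smul_eq_mul]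
        have h3 : 0 < R.form γ δ := by
          by_contra h3
          nlinarith
        nlinarith
      · rw [Set.mem_singleton_iff.1 h2] at hδx
        linarith
  · rintro δ ⟨⟨-, hδ⟩, -⟩ δ' ⟨⟨-, hδ'⟩, -⟩ h1
    dsimp only at h1
    split_ifs at h1 with h2 h3 h3
    · exact R.ρ_injective t h1
    · rw [← h1, h.apply_apply] at h3
      exact absurd hδ h3
    · rw [h1, h.apply_apply] at h2
      exact absurd hδ' h2
    · exact h1

/-- `α` is a simple root, with reflection `s`, of the root subsystem in `P`. -/
structure IsSimpleIn (P : Submodule ℝ V) (s : W) (α : V) : Prop where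
  isRootOf : R.IsRootOf s α
  height_pos : 0 < R.height α
  mem : α ∈ P
  apply_pos : ∀ δ ∈ R.posRoots, δ ∈ P → δ ≠ α → 0 < R.height (R.ρ s δ)

theorem IsSimpleIn.level_mul [Finite W] {P : Submodule ℝ V} {s x : W} {α : V}
    (h : R.IsSimpleIn P s α) (hx : 0 < R.height (R.ρ x α)) :
    R.level P (x * s) = R.level P x + 1 := by
  have hr := h.isRootOf
  have : R.inversions P (x * s) = insert α (R.ρ s '' R.inversions P x) := by
    ext δ
    constructor
    · rintro ⟨⟨⟨t, ht⟩, hδ⟩, hδP, hδx⟩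
      by_cases hne : δ = α
      · exact Or.inl hne
      refine Or.inr ⟨R.ρ s δ, ⟨⟨⟨_, ht.conj s⟩, h.apply_pos δ ⟨⟨t, ht⟩, hδ⟩ hδP hne⟩,
        hr.apply_mem h.mem hδP, by rwa [R.ρ_mul_apply] at hδx⟩, hr.apply_apply δ⟩
    · rintro (rfl | ⟨δ, ⟨⟨⟨t, ht⟩, hδ⟩, hδP, hδx⟩, rfl⟩)
      · refine ⟨⟨⟨s, hr⟩, h.height_pos⟩, h.mem, ?_⟩
        rw [R.ρ_mul_apply, hr.apply_self, map_neg, map_neg]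
        linarith
      · refine ⟨⟨⟨_, ht.conj s⟩, h.apply_pos δ ⟨⟨t, ht⟩, hδ⟩ hδP ?_⟩, hr.apply_mem h.mem hδP, ?_⟩
        · rintro rfl
          linarith
        · rwa [R.ρ_mul_apply, hr.apply_apply]
  rw [level, this, Set.ncard_insert_of_notMem _ ((finite_inversions _ _).image _),
    Set.ncard_image_of_injective _ (R.ρ_injective s), level]
  rintro ⟨δ, ⟨⟨-, hδ⟩, -⟩, h1⟩
  have h2 := congrArg (R.ρ s) h1
  rw [hr.apply_apply, hr.apply_self] at h2
  rw [h2, map_neg] at hδ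
  linarith [h.height_pos]

theorem IsSimpleIn.level_mul_of_neg [Finite W] {P : Submodule ℝ V} {s x : W} {α : V}
    (h : R.IsSimpleIn P s α) (hx : R.height (R.ρ x α) < 0) :
    R.level P (x * s) + 1 = R.level P x := by
  have := h.level_mul (x := x * s) (by
    rw [R.ρ_mul_apply, h.isRootOf.apply_self, map_neg, map_neg]
    linarith)
  rwa [mul_assoc, h.isRootOf.mul_self, mul_one, eq_comm] at this

theorem isSimpleIn_top (i : B) : R.IsSimpleIn ⊤ (cs.simple i) (R.root i) where
  isRootOf := R.isRootOf_simple i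
  height_pos := R.height_root i
  mem := trivial
  apply_pos := by
    rintro δ ⟨⟨_, w, j, rfl, rfl⟩, hδ⟩ - hne
    exact R.height_simple_pos w j i hδ hne

theorem level_top [Finite W] (w : W) : R.level ⊤ w = cs.length w := by
  induction w using cs.simple_induction_right with
  | one =>
    rw [cs.length_one, level, Set.ncard_eq_zero (finite_inversions _ _),
      Set.eq_empty_iff_forall_notMem]
    rintro γ ⟨⟨-, h1⟩, -, h2⟩
    rw [map_one, Module.End.one_apply] at h2
    linarith
  | mul_simple_right w i ih =>
    by_cases hi : cs.IsRightDescent w i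
    · have h1 := (isSimpleIn_top (R := R) i).level_mul_of_neg (x := w) (by
        have := R.height_pos (w * cs.simple i) i
          (cs.isRightDescent_iff_not_isRightDescent_mul.1 hi)
        rw [R.ρ_mul_apply, simple_root, map_neg, map_neg] at this
        linarith)
      have h2 := cs.isRightDescent_iff.1 hi
      omega
    · rw [(isSimpleIn_top i).level_mul (R.height_pos w i hi), ih, cs.not_isRightDescent_iff.1 hi]

theorem IsRootOf.length_lt [Finite W] {t x : W} {γ : V} (h : R.IsRootOf t γ)
    (hγ : 0 < R.height γ) (hx : 0 < R.height (R.ρ x γ)) :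
    cs.length x < cs.length (x * t) := by
  rw [← R.level_top, ← R.level_top]
  exact h.level_lt trivial hγ hx

theorem IsRootOf.length_lt_iff [Finite W] {t x : W} {γ : V} (h : R.IsRootOf t γ)
    (hγ : 0 < R.height γ) :
    cs.length x < cs.length (x * t) ↔ 0 < R.height (R.ρ x γ) := by
  refine ⟨fun hl => ?_, h.length_lt hγ⟩
  by_contra hx
  have h1 := h.length_lt (x := x * t) hγ (by
    rw [R.ρ_mul_apply, h.apply_self, map_neg, map_neg]
    have := (h.conj x).height_ne_zero
    have := lt_of_le_of_ne (not_lt.1 hx) this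
    linarith)
  rw [mul_assoc, h.mul_self, mul_one] at h1
  omega

variable (R) in
/-- A Bruhat step multiplies on the right by a reflection whose positive root stays positive. -/
theorem bruhatStep_iff [Finite W] {a b : W} : BruhatStep cs a b ↔
    ∃ t γ, R.IsRootOf t γ ∧ 0 < R.height γ ∧ 0 < R.height (R.ρ a γ) ∧ b = a * t := by
  constructor
  · rintro ⟨s, hs, rfl, hlt⟩
    obtain ⟨γ, h, hγ⟩ := R.exists_isRootOf (hs.conj a⁻¹)
    have hb : s * a = a * (a⁻¹ * s * a⁻¹⁻¹) := by group
    rw [hb] at hlt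
    exact ⟨_, γ, h, hγ, (h.length_lt_iff hγ).1 hlt, hb⟩
  · rintro ⟨t, γ, h, hγ, ha, rfl⟩
    exact ⟨a * t * a⁻¹, (h.conj a).isReflection, by group, h.length_lt hγ ha⟩

end RootRep

namespace RootRep

variable {cs : CoxeterSystem M W} {V : Type*} [AddCommGroup V] [Module ℝ V] (R : RootRep cs V)

/-- The reflections with a root in `P`. -/
def IsReflectionIn (P : Submodule ℝ V) (r : W) : Prop := ∃ γ, R.IsRootOf r γ ∧ γ ∈ P

/-- `α` and `β`, with reflections `s` and `t`, form the base of a root subsystem of rank two. -/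
structure IsBase (P : Submodule ℝ V) (s t : W) (α β : V) : Prop where
  isRootOf_left : R.IsRootOf s α
  isRootOf_right : R.IsRootOf t β
  pos_left : 0 < R.height α
  pos_right : 0 < R.height β
  mem_left : α ∈ P
  mem_right : β ∈ P
  ne : α ≠ β
  exists_eq : ∀ γ ∈ R.posRoots, γ ∈ P → ∃ a b : ℝ, 0 ≤ a ∧ 0 ≤ b ∧ γ = a • α + b • β

variable {R}

theorem eq_of_smul_eq {α β : V} (hα : α ∈ R.posRoots) (hβ : β ∈ R.posRoots) {c : ℝ}
    (h : β = c • α) : β = α := by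
  obtain ⟨⟨s, hs⟩, hα⟩ := hα
  obtain ⟨⟨t, ht⟩, hβ⟩ := hβ
  refine (hs.eq_or_eq_neg ht h).resolve_right fun h' => ?_
  rw [h', map_neg] at hβ
  linarith

theorem exists_pos_of_isReflectionIn {P : Submodule ℝ V} {r : W} (h : R.IsReflectionIn P r) :
    ∃ γ, R.IsRootOf r γ ∧ γ ∈ P ∧ 0 < R.height γ := by
  obtain ⟨γ, h, hP⟩ := h
  rcases h.height_ne_zero.lt_or_gt with h' | h'
  · exact ⟨-γ, h.neg, P.neg_mem hP, by rw [map_neg]; linarith⟩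
  · exact ⟨γ, h, hP, h'⟩

theorem mem_span_of_ne {β γ δ : V} (hβ : β ∈ R.posRoots)
    (hδ : δ ∈ R.posRoots) (hne : δ ≠ β) (h : δ ∈ Submodule.span ℝ {β, γ}) :
    γ ∈ Submodule.span ℝ {β, δ} := by
  obtain ⟨a, b, rfl⟩ := Submodule.mem_span_pair.1 h
  have hb : b ≠ 0 := by
    rintro rfl
    exact hne (eq_of_smul_eq hβ hδ (c := a) (by simp))
  refine Submodule.mem_span_pair.2 ⟨-(b⁻¹ * a), b⁻¹, ?_⟩
  rw [smul_add, smul_smul, smul_smul, inv_mul_cancel₀ hb]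
  module

theorem exists_isBase [Finite W] {γ₁ γ₂ : V} (h₁ : γ₁ ∈ R.posRoots) (h₂ : γ₂ ∈ R.posRoots)
    (hne : γ₂ ≠ γ₁) : ∃ s t α β, R.IsBase (Submodule.span ℝ {γ₁, γ₂}) s t α β := by
  set P := Submodule.span ℝ {γ₁, γ₂} with hP
  have hnot : γ₂ ∉ Submodule.span ℝ {γ₁} := fun h => by
    obtain ⟨c, hc⟩ := Submodule.mem_span_singleton.1 h
    exact hne (eq_of_smul_eq h₁ h₂ hc.symm)
  obtain ⟨d, hd2, hd1⟩ := Submodule.exists_dual_map_eq_bot_of_notMem hnot inferInstance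
  have hd1 : d γ₁ = 0 := by
    have : d γ₁ ∈ (Submodule.span ℝ {γ₁}).map d :=
      Submodule.mem_map_of_mem (Submodule.mem_span_singleton_self γ₁)
    rwa [hd1, Submodule.mem_bot] at this
  have hm1 : γ₁ ∈ P := Submodule.subset_span (by simp)
  have hm2 : γ₂ ∈ P := Submodule.subset_span (by simp)
  have hinj : ∀ x ∈ P, d x = 0 → R.height x = 0 → x = 0 := by
    intro x hx hdx hx0
    obtain ⟨a, b, rfl⟩ := Submodule.mem_span_pair.1 hx
    simp only [map_add, map_smul, hd1, smul_eq_mul, mul_zero, zero_add] at hdx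
    have hb : b = 0 := (mul_eq_zero.1 hdx).resolve_right hd2
    simp only [hb, zero_smul, add_zero, map_smul, smul_eq_mul] at hx0 ⊢
    rw [(mul_eq_zero.1 hx0).resolve_right h₁.2.ne', zero_smul]
  have hfin : (R.posRoots ∩ P).Finite := finite_posRoots.subset Set.inter_subset_left
  have hnon : (R.posRoots ∩ P).Nonempty := ⟨γ₁, h₁, hm1⟩
  obtain ⟨α, ⟨⟨⟨s, hs⟩, hα⟩, hαP⟩, hmin⟩ :=
    Set.exists_min_image _ (fun x => d x / R.height x) hfin hnon
  obtain ⟨β, ⟨⟨⟨t, ht⟩, hβ⟩, hβP⟩, hmax⟩ :=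
    Set.exists_max_image _ (fun x => d x / R.height x) hfin hnon
  have hlt : d α / R.height α < d β / R.height β := by
    have h1 := hmin _ ⟨h₁, hm1⟩
    have h2 := hmin _ ⟨h₂, hm2⟩
    have h3 := hmax _ ⟨h₁, hm1⟩
    have h4 := hmax _ ⟨h₂, hm2⟩
    refine lt_of_le_of_ne (h1.trans h3) fun heq => div_ne_zero hd2 h₂.2.ne' ?_
    simp only [hd1, zero_div] at h1 h3
    linarith
  refine ⟨s, t, α, β, hs, ht, hα, hβ, hαP, hβP, by rintro rfl; exact lt_irrefl _ hlt, ?_⟩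
  intro γ hγ hγP
  have hD := (div_lt_div_iff₀ hα hβ).1 hlt
  have hD1 := (div_le_div_iff₀ hα hγ.2).1 (hmin γ ⟨hγ, hγP⟩)
  have hD2 := (div_le_div_iff₀ hγ.2 hβ).1 (hmax γ ⟨hγ, hγP⟩)
  have hD0 : d β * R.height α - d α * R.height β ≠ 0 := by linarith
  refine ⟨(d β * R.height γ - d γ * R.height β) / (d β * R.height α - d α * R.height β),
    (d γ * R.height α - d α * R.height γ) / (d β * R.height α - d α * R.height β),
    div_nonneg (by linarith) (by linarith), div_nonneg (by linarith) (by linarith), ?_⟩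
  refine sub_eq_zero.1 (hinj _ (P.sub_mem hγP (P.add_mem (P.smul_mem _ hαP)
    (P.smul_mem _ hβP))) ?_ ?_)
  · simp only [map_sub, map_add, map_smul, smul_eq_mul]
    rw [sub_eq_zero, div_mul_eq_mul_div, div_mul_eq_mul_div, ← add_div, eq_div_iff hD0]
    ring
  · simp only [map_sub, map_add, map_smul, smul_eq_mul]
    rw [sub_eq_zero, div_mul_eq_mul_div, div_mul_eq_mul_div, ← add_div, eq_div_iff hD0]
    ring

namespace IsBase

variable {P : Submodule ℝ V} {s t : W} {α β : V}

theorem symm (h : R.IsBase P s t α β) : R.IsBase P t s β α where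
  isRootOf_left := h.isRootOf_right
  isRootOf_right := h.isRootOf_left
  pos_left := h.pos_right
  pos_right := h.pos_left
  mem_left := h.mem_right
  mem_right := h.mem_left
  ne := h.ne.symm
  exists_eq γ hγ hP := by
    obtain ⟨a, b, ha, hb, hab⟩ := h.exists_eq γ hγ hP
    exact ⟨b, a, hb, ha, by rw [hab, add_comm]⟩

theorem isSimpleIn (h : R.IsBase P s t α β) : R.IsSimpleIn P s α where
  isRootOf := h.isRootOf_left
  height_pos := h.pos_left
  mem := h.mem_left
  apply_pos := by
    rintro δ ⟨⟨r, hr⟩, hδ⟩ hδP hne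
    have hs := h.isRootOf_left
    have hr' := hr.conj s
    by_contra hneg
    have hlt := lt_of_le_of_ne (not_lt.1 hneg) hr'.height_ne_zero
    obtain ⟨a, b, ha, hb, hab⟩ := h.exists_eq δ ⟨⟨r, hr⟩, hδ⟩ hδP
    obtain ⟨a', b', ha', hb', hab'⟩ := h.exists_eq (-R.ρ s δ)
      ⟨⟨_, hr'.neg⟩, by rw [map_neg]; linarith⟩ (P.neg_mem (hs.apply_mem h.mem_left hδP))
    have key : (b + b') • β = (R.form α δ - a - a') • α := by
      rw [hs.apply] at hab'
      linear_combination (norm := module) -hab' - hab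
    rcases (add_nonneg hb hb').eq_or_lt with h0 | h0
    · have hb0 : b = 0 := by linarith
      refine hne (eq_of_smul_eq ⟨⟨s, hs⟩, h.pos_left⟩ ⟨⟨r, hr⟩, hδ⟩ (c := a) ?_)
      rw [hab, hb0, zero_smul, add_zero]
    · refine h.ne.symm (eq_of_smul_eq ⟨⟨s, hs⟩, h.pos_left⟩ ⟨⟨t, h.isRootOf_right⟩, h.pos_right⟩
        (c := (b + b')⁻¹ * (R.form α δ - a - a')) ?_)
      rw [mul_smul, ← key, smul_smul, inv_mul_cancel₀ h0.ne', one_smul]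

theorem height_pos_of_pos (h : R.IsBase P s t α β) {x : W} (hα : 0 < R.height (R.ρ x α))
    (hβ : 0 < R.height (R.ρ x β)) {γ : V} (hγ : γ ∈ R.posRoots) (hP : γ ∈ P) :
    0 < R.height (R.ρ x γ) := by
  obtain ⟨a, b, ha, hb, rfl⟩ := h.exists_eq γ hγ hP
  obtain ⟨⟨r, hr⟩, -⟩ := hγ
  have := (hr.conj x).height_ne_zero
  simp only [map_add, map_smul, smul_eq_mul] at this ⊢
  exact lt_of_le_of_ne (by positivity) this.symm

theorem height_neg_of_neg (h : R.IsBase P s t α β) {x : W} (hα : R.height (R.ρ x α) < 0)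
    (hβ : R.height (R.ρ x β) < 0) {γ : V} (hγ : γ ∈ R.posRoots) (hP : γ ∈ P) :
    R.height (R.ρ x γ) < 0 := by
  obtain ⟨a, b, ha, hb, rfl⟩ := h.exists_eq γ hγ hP
  obtain ⟨⟨r, hr⟩, -⟩ := hγ
  have := (hr.conj x).height_ne_zero
  simp only [map_add, map_smul, smul_eq_mul] at this ⊢
  exact lt_of_le_of_ne (by nlinarith) this

theorem mul_zpow_left (h : R.IsBase P s t α β) (k : ℤ) : s * (s * t) ^ k = (s * t) ^ (-k) * s := by
  have h1 : s * (s * t) * s⁻¹ = (s * t)⁻¹ := by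
    rw [mul_inv_rev, h.isRootOf_left.inv_eq, h.isRootOf_right.inv_eq, ← mul_assoc,
      h.isRootOf_left.mul_self, one_mul]
  rw [zpow_neg, ← inv_zpow, ← h1, conj_zpow, inv_mul_cancel_right]

theorem inv_mul_left (h : R.IsBase P s t α β) : (s * t)⁻¹ * s = t := by
  rw [mul_inv_rev, inv_mul_cancel_right, h.isRootOf_right.inv_eq]

theorem exists_zpow [Finite W] (h : R.IsBase P s t α β) {r : W} (hr : R.IsReflectionIn P r) :
    ∃ k : ℤ, r = (s * t) ^ k * s := by
  obtain ⟨γ, hrγ, hP, hγ⟩ := exists_pos_of_isReflectionIn hr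
  clear hr
  rename' hrγ => hr
  induction hn : {δ ∈ R.posRoots | R.height δ < R.height γ}.ncard using Nat.strong_induction_on
    generalizing r γ with
  | _ n ih =>
    subst hn
    have key : ∀ (s' : W) (α' : V), R.IsSimpleIn P s' α' → γ ≠ α' → 0 < R.form α' γ →
        ∃ k : ℤ, s' * r * s'⁻¹ = (s * t) ^ k * s := by
      intro s' α' hs' hne hpos
      have hr' := hs'.isRootOf
      have hpos' := hs'.apply_pos γ ⟨⟨r, hr⟩, hγ⟩ hP hne
      have hlt : R.height (R.ρ s' γ) < R.height γ := by
        rw [hr'.apply, map_sub, map_smul, smul_eq_mul]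
        nlinarith [hs'.height_pos]
      have hsub : {δ ∈ R.posRoots | R.height δ < R.height (R.ρ s' γ)} ⊂
          {δ ∈ R.posRoots | R.height δ < R.height γ} := by
        refine ⟨fun δ hδ => ⟨hδ.1, hδ.2.trans hlt⟩, fun hsub => ?_⟩
        have hmem : R.ρ s' γ ∈ {δ ∈ R.posRoots | R.height δ < R.height γ} :=
          ⟨⟨⟨_, hr.conj s'⟩, hpos'⟩, hlt⟩
        exact lt_irrefl _ (hsub hmem).2
      exact ih _ (Set.ncard_lt_ncard hsub (finite_posRoots.subset fun δ hδ => hδ.1)) _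
        (hr.conj s') (hr'.apply_mem hs'.mem hP) hpos' rfl
    by_cases hγα : γ = α
    · exact ⟨0, by rw [zpow_zero, one_mul]; exact hr.reflection_unique (hγα ▸ h.isRootOf_left)⟩
    by_cases hγβ : γ = β
    · exact ⟨-1, by
        rw [zpow_neg_one, h.inv_mul_left]; exact hr.reflection_unique (hγβ ▸ h.isRootOf_right)⟩
    obtain ⟨a, b, ha, hb, hab⟩ := h.exists_eq γ ⟨⟨r, hr⟩, hγ⟩ hP
    have h2 : 2 = a * R.form α γ + b * R.form β γ := by
      rw [← hr.form_self]
      nth_rw 1 [hab]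
      simp
    by_cases hα : 0 < R.form α γ
    · obtain ⟨k, hk⟩ := key s α h.isSimpleIn hγα hα
      refine ⟨-k, ?_⟩
      calc r = s⁻¹ * (s * r * s⁻¹) * s := by group
        _ = s * (s * t) ^ k * (s * s) := by
          rw [hk, h.isRootOf_left.inv_eq]
          simp only [mul_assoc]
        _ = (s * t) ^ (-k) * s := by rw [h.isRootOf_left.mul_self, mul_one, h.mul_zpow_left]
    · obtain ⟨k, hk⟩ := key t β h.symm.isSimpleIn hγβ (by by_contra h'; nlinarith)
      refine ⟨-1 + -k + -1, ?_⟩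
      calc r = t⁻¹ * (t * r * t⁻¹) * t := by group
        _ = (s * t)⁻¹ * s * ((s * t) ^ k * s) * ((s * t)⁻¹ * s) := by
          rw [hk, h.isRootOf_right.inv_eq, h.inv_mul_left]
        _ = (s * t)⁻¹ * (s * (s * t) ^ k) * s * ((s * t)⁻¹ * s) := by simp only [mul_assoc]
        _ = (s * t)⁻¹ * (s * t) ^ (-k) * (s * s) * (s * t)⁻¹ * s := by
          rw [h.mul_zpow_left]
          simp only [mul_assoc]
        _ = (s * t) ^ (-1 + -k + -1) * s := by
          rw [h.isRootOf_left.mul_self, mul_one, zpow_add, zpow_add, zpow_neg_one]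

theorem apply_mem (h : R.IsBase P s t α β) (k : ℤ) {x : V} (hx : x ∈ P) :
    R.ρ ((s * t) ^ k) x ∈ P := by
  have hs : ∀ x ∈ P, R.ρ s x ∈ P := fun x => h.isRootOf_left.apply_mem h.mem_left
  have ht : ∀ x ∈ P, R.ρ t x ∈ P := fun x => h.isRootOf_right.apply_mem h.mem_right
  induction k using Int.induction_on generalizing x with
  | zero => simpa using hx
  | succ k ih =>
    rw [zpow_add_one, R.ρ_mul_apply, R.ρ_mul_apply]
    exact ih (hs _ (ht _ hx))
  | pred k ih =>
    rw [zpow_sub_one, R.ρ_mul_apply, mul_inv_rev, R.ρ_mul_apply, h.isRootOf_left.inv_eq,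
      h.isRootOf_right.inv_eq]
    exact ih (ht _ (hs _ hx))

theorem isReflectionIn_zpow (h : R.IsBase P s t α β) (k : ℤ) :
    R.IsReflectionIn P ((s * t) ^ k * s) := by
  have key : ∀ j : ℤ, (s * t) ^ (j + j) * s = (s * t) ^ j * s * ((s * t) ^ j)⁻¹ := fun j => by
    rw [mul_assoc, ← zpow_neg, h.mul_zpow_left, neg_neg, zpow_add, mul_assoc]
  rcases k.even_or_odd with ⟨j, rfl⟩ | ⟨j, rfl⟩
  · rw [key]
    exact ⟨_, h.isRootOf_left.conj _, h.apply_mem j h.mem_left⟩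
  · have : (s * t) ^ (2 * j + 1) * s = (s * t) ^ j * (s * t * s⁻¹) * ((s * t) ^ j)⁻¹ := by
      rw [h.isRootOf_left.inv_eq, mul_assoc, ← zpow_neg, mul_assoc (s * t) s, h.mul_zpow_left,
        neg_neg, two_mul, add_assoc, add_comm j 1, zpow_add, zpow_one_add]
      simp only [mul_assoc]
    rw [this]
    exact ⟨_, (h.isRootOf_right.conj s).conj _,
      h.apply_mem j (h.isRootOf_left.apply_mem h.mem_left h.mem_right)⟩

theorem isReflectionIn_mul_mul [Finite W] (h : R.IsBase P s t α β) {p q r : W}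
    (hp : R.IsReflectionIn P p) (hq : R.IsReflectionIn P q) (hr : R.IsReflectionIn P r) :
    R.IsReflectionIn P (p * q * r) := by
  obtain ⟨i, rfl⟩ := h.exists_zpow hp
  obtain ⟨j, rfl⟩ := h.exists_zpow hq
  obtain ⟨k, rfl⟩ := h.exists_zpow hr
  have : (s * t) ^ i * s * ((s * t) ^ j * s) * ((s * t) ^ k * s) = (s * t) ^ (i + -j + k) * s := by
    rw [mul_assoc _ s, ← mul_assoc s, h.mul_zpow_left, mul_assoc _ s s, h.isRootOf_left.mul_self,
      mul_one, zpow_add, zpow_add]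
    simp only [mul_assoc]
  rw [this]
  exact h.isReflectionIn_zpow _

end IsBase

end RootRep

namespace RootRep

variable {cs : CoxeterSystem M W} {V : Type*} [AddCommGroup V] [Module ℝ V] {R : RootRep cs V}

/-- Multiply `x` on the right by `s`, `t`, `s`, … alternately. -/
def alternatingMul (x s t : W) : ℕ → W
  | 0 => x
  | n + 1 => alternatingMul x s t n * if Even n then s else t

namespace IsBase

variable {P : Submodule ℝ V} {s t : W} {α β : V}

theorem mem_closure (h : R.IsBase P s t α β) {g : W} (hg : g ∈ Subgroup.closure {s, t}) :
    ∃ k : ℤ, g = (s * t) ^ k ∨ g = (s * t) ^ k * s := by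
  induction hg using Subgroup.closure_induction with
  | mem x hx =>
    rcases hx with rfl | rfl
    · exact ⟨0, Or.inr (by simp)⟩
    · exact ⟨-1, Or.inr (by rw [zpow_neg_one, h.inv_mul_left])⟩
  | one => exact ⟨0, Or.inl (by simp)⟩
  | mul x y _ _ hx hy =>
    obtain ⟨i, rfl | rfl⟩ := hx <;> obtain ⟨j, rfl | rfl⟩ := hy
    · exact ⟨i + j, Or.inl (zpow_add _ _ _).symm⟩
    · exact ⟨i + j, Or.inr (by rw [zpow_add, mul_assoc])⟩
    · exact ⟨i + -j, Or.inr (by rw [mul_assoc, h.mul_zpow_left, zpow_add, mul_assoc])⟩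
    · exact ⟨i + -j, Or.inl (by
        rw [mul_assoc, ← mul_assoc s, h.mul_zpow_left, mul_assoc _ s, h.isRootOf_left.mul_self,
          mul_one, zpow_add])⟩
  | inv x _ hx =>
    obtain ⟨k, rfl | rfl⟩ := hx
    · exact ⟨-k, Or.inl (zpow_neg _ _).symm⟩
    · exact ⟨k, Or.inr (by
        rw [mul_inv_rev, ← zpow_neg, h.isRootOf_left.inv_eq, h.mul_zpow_left, neg_neg])⟩

theorem alternatingMul_mem {x u : W} (s t : W) (hu : x⁻¹ * u ∈ Subgroup.closure {s, t}) (j : ℕ) :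
    u⁻¹ * alternatingMul x s t j ∈ Subgroup.closure {s, t} := by
  induction j with
  | zero => simpa [alternatingMul] using inv_mem hu
  | succ j ih =>
    rw [alternatingMul, ← mul_assoc]
    refine mul_mem ih (Subgroup.subset_closure ?_)
    split_ifs <;> simp

theorem level_eq_of_neg (h : R.IsBase P s t α β) {x : W} (hα : R.height (R.ρ x α) < 0)
    (hβ : R.height (R.ρ x β) < 0) : R.level P x = (R.posRoots ∩ P).ncard := by
  rw [level]
  congr 1
  ext γ
  exact ⟨fun h' => ⟨h'.1, h'.2.1⟩, fun h' => ⟨h'.1, h'.2, h.height_neg_of_neg hα hβ h'.1 h'.2⟩⟩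

variable [Finite W]

theorem mem_closure_of_isReflectionIn (h : R.IsBase P s t α β) {r : W}
    (hr : R.IsReflectionIn P r) : r ∈ Subgroup.closure {s, t} := by
  obtain ⟨k, rfl⟩ := h.exists_zpow hr
  have hs : s ∈ Subgroup.closure {s, t} := Subgroup.subset_closure (by simp)
  have ht : t ∈ Subgroup.closure {s, t} := Subgroup.subset_closure (by simp)
  exact mul_mem (zpow_mem (mul_mem hs ht) k) hs

theorem even_level_mul (h : R.IsBase P s t α β) (x : W) :
    Even (R.level P (x * s)) ↔ ¬ Even (R.level P x) := by
  rcases (h.isRootOf_left.conj x).height_ne_zero.lt_or_gt with h' | h'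
  · rw [← h.isSimpleIn.level_mul_of_neg h', Nat.even_add_one, not_not]
  · rw [h.isSimpleIn.level_mul h', Nat.even_add_one]

theorem even_level_mul_zpow (h : R.IsBase P s t α β) (x : W) (k : ℤ) :
    Even (R.level P (x * (s * t) ^ k)) ↔ Even (R.level P x) := by
  have h2 : ∀ y, Even (R.level P (y * (s * t))) ↔ Even (R.level P y) := fun y => by
    rw [← mul_assoc, h.symm.even_level_mul, h.even_level_mul, not_not]
  induction k using Int.induction_on with
  | zero => simp
  | succ k ih =>
    rw [zpow_add_one, ← mul_assoc, h2]
    exact ih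
  | pred k ih =>
    rw [← h2 (x * (s * t) ^ (-(k : ℤ) - 1)), mul_assoc, zpow_sub_one, inv_mul_cancel_right]
    exact ih

theorem isReflectionIn_of_even_level (h : R.IsBase P s t α β) {x y : W}
    (hxy : x⁻¹ * y ∈ Subgroup.closure {s, t})
    (hl : Even (R.level P x) ↔ ¬ Even (R.level P y)) : R.IsReflectionIn P (x⁻¹ * y) := by
  obtain ⟨k, hk | hk⟩ := h.mem_closure hxy
  · have := h.even_level_mul_zpow x k
    rw [← hk, mul_inv_cancel_left] at this
    tauto
  · rw [hk]
    exact h.isReflectionIn_zpow k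

theorem even_level_of_isReflectionIn (h : R.IsBase P s t α β) {x r : W}
    (hr : R.IsReflectionIn P r) : Even (R.level P (x * r)) ↔ ¬ Even (R.level P x) := by
  obtain ⟨k, rfl⟩ := h.exists_zpow hr
  rw [← mul_assoc, h.even_level_mul, h.even_level_mul_zpow]

theorem bruhatStep_of_level_lt (h : R.IsBase P s t α β) {x y : W}
    (hxy : x⁻¹ * y ∈ Subgroup.closure {s, t})
    (hl : Even (R.level P x) ↔ ¬ Even (R.level P y)) (hlt : R.level P x < R.level P y) :
    BruhatStep cs x y := by
  obtain ⟨γ, hr, hP, hγ⟩ := exists_pos_of_isReflectionIn (h.isReflectionIn_of_even_level hxy hl)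
  refine R.bruhatStep_iff.2 ⟨_, γ, hr, hγ, ?_, by group⟩
  by_contra hneg
  have hneg := lt_of_le_of_ne (not_lt.1 hneg) (hr.conj x).height_ne_zero
  have h1 := hr.level_lt (x := x * (x⁻¹ * y)) hP hγ (by
    rw [R.ρ_mul_apply, hr.apply_self, map_neg, map_neg]
    linarith)
  rw [mul_assoc, hr.mul_self, mul_one, mul_inv_cancel_left] at h1
  omega

theorem exists_level_eq_zero (h : R.IsBase P s t α β) (u : W) :
    ∃ x, R.level P x = 0 ∧ x⁻¹ * u ∈ Subgroup.closure {s, t} := by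
  have hs : s ∈ Subgroup.closure {s, t} := Subgroup.subset_closure (by simp)
  have ht : t ∈ Subgroup.closure {s, t} := Subgroup.subset_closure (by simp)
  induction hn : R.level P u using Nat.strong_induction_on generalizing u with
  | _ n ih =>
    subst hn
    rcases (h.isRootOf_left.conj u).height_ne_zero.lt_or_gt with hα | hα
    · obtain ⟨x, hx, hxu⟩ := ih _ (by have := h.isSimpleIn.level_mul_of_neg hα; omega) (u * s) rfl
      refine ⟨x, hx, ?_⟩
      simpa [mul_assoc, h.isRootOf_left.mul_self] using mul_mem hxu hs
    rcases (h.isRootOf_right.conj u).height_ne_zero.lt_or_gt with hβ | hβ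
    · obtain ⟨x, hx, hxu⟩ :=
        ih _ (by have := h.symm.isSimpleIn.level_mul_of_neg hβ; omega) (u * t) rfl
      refine ⟨x, hx, ?_⟩
      simpa [mul_assoc, h.isRootOf_right.mul_self] using mul_mem hxu ht
    refine ⟨u, ?_, by simp [one_mem]⟩
    rw [level, Set.ncard_eq_zero (finite_inversions _ _), Set.eq_empty_iff_forall_notMem]
    rintro γ ⟨h1, h2, h3⟩
    have := h.height_pos_of_pos hα hβ h1 h2
    linarith

theorem level_le (P : Submodule ℝ V) (x : W) : R.level P x ≤ (R.posRoots ∩ P).ncard :=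
  Set.ncard_le_ncard (fun _ h => ⟨h.1, h.2.1⟩) (finite_posRoots.subset Set.inter_subset_left)

theorem level_alternatingMul (h : R.IsBase P s t α β) {x : W} (hx : R.level P x = 0) {j : ℕ}
    (hj : j ≤ (R.posRoots ∩ P).ncard) : R.level P (alternatingMul x s t j) = j := by
  induction j using Nat.strong_induction_on with
  | _ j ih =>
  match j with
  | 0 => exact hx
  | 1 =>
    have : alternatingMul x s t 1 = x * s := by simp [alternatingMul]
    rw [this, h.isSimpleIn.level_mul, hx]
    by_contra hneg
    have hneg := lt_of_le_of_ne (not_lt.1 hneg) (h.isRootOf_left.conj x).height_ne_zero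
    have := h.isSimpleIn.level_mul_of_neg hneg
    omega
  | j + 2 =>
    have h1 := ih (j + 1) (by omega) (by omega)
    have h0 := ih j (by omega) (by omega)
    have key : ∀ {s t : W} {α β : V} {y : W}, R.IsBase P s t α β → R.level P y = j →
        R.level P (y * s) = j + 1 → R.level P (y * s * t) = j + 2 := by
      intro s t α β y h h0 h1
      have hα : R.height (R.ρ (y * s) α) < 0 := by
        by_contra hα
        have hα := lt_of_le_of_ne (not_lt.1 hα) (h.isRootOf_left.conj _).height_ne_zero.symm
        have := h.isSimpleIn.level_mul hα
        rw [mul_assoc, h.isRootOf_left.mul_self, mul_one] at this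
        omega
      have hβ : 0 < R.height (R.ρ (y * s) β) := by
        by_contra hβ
        have hβ := lt_of_le_of_ne (not_lt.1 hβ) (h.isRootOf_right.conj _).height_ne_zero
        have := h.level_eq_of_neg hα hβ
        omega
      rw [h.symm.isSimpleIn.level_mul hβ, h1]
    rw [alternatingMul, alternatingMul]
    rw [alternatingMul] at h1
    by_cases he : Even j
    · simp only [he, Nat.even_add_one, not_true, if_true, if_false] at h1 ⊢
      exact key h h0 h1
    · simp only [he, Nat.even_add_one, not_false_eq_true, if_true, if_false] at h1 ⊢
      exact key h.symm h0 h1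

theorem alternatingMul_ne (h : R.IsBase P s t α β) {x : W} (hx : R.level P x = 0) {j : ℕ}
    (hj : j + 1 < (R.posRoots ∩ P).ncard) :
    alternatingMul x s t (j + 1) ≠ alternatingMul x t s (j + 1) := by
  intro heq
  have hneg : ∀ {s t : W} {α β : V}, R.IsBase P s t α β →
      R.height (R.ρ (alternatingMul x s t (j + 1)) (if Even j then α else β)) < 0 := by
    intro s t α β h
    have h0 := h.level_alternatingMul hx (show j ≤ _ by omega)
    have h1 := h.level_alternatingMul hx hj.le
    rw [alternatingMul] at h1 ⊢
    have hs : R.IsSimpleIn P (if Even j then s else t) (if Even j then α else β) := by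
      split_ifs
      · exact h.isSimpleIn
      · exact h.symm.isSimpleIn
    by_contra hneg
    have hneg := lt_of_le_of_ne (not_lt.1 hneg) (hs.isRootOf.conj _).height_ne_zero.symm
    have := hs.level_mul hneg
    rw [mul_assoc, hs.isRootOf.mul_self, mul_one] at this
    omega
  have h1 := hneg h
  have h2 := hneg h.symm
  rw [← heq] at h2
  have h3 := h.level_alternatingMul hx hj.le
  have h4 : R.level P (alternatingMul x s t (j + 1)) = (R.posRoots ∩ P).ncard := by
    by_cases he : Even j
    · simp only [he, if_true] at h1 h2
      exact h.level_eq_of_neg h1 h2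
    · simp only [he, if_false] at h1 h2
      exact h.level_eq_of_neg h2 h1
  omega

end IsBase
end RootRep

/-- Two elements joined by two distinct Bruhat paths of length three that cross. -/
def Butterfly (cs : CoxeterSystem M W) (u v : W) : Prop :=
  ∃ a b c d, a ≠ b ∧ c ≠ d ∧ BruhatStep cs u a ∧ BruhatStep cs u b ∧ BruhatStep cs a c ∧
    BruhatStep cs a d ∧ BruhatStep cs b c ∧ BruhatStep cs b d ∧ BruhatStep cs c v ∧
    BruhatStep cs d v

namespace RootRep

variable {cs : CoxeterSystem M W} {V : Type*} [AddCommGroup V] [Module ℝ V] {R : RootRep cs V}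

theorem IsBase.butterfly [Finite W] {P : Submodule ℝ V} {s t : W} {α β : V}
    (h : R.IsBase P s t α β) {u r : W} (hr : R.IsReflectionIn P r)
    (hl : R.level P u + 2 ≤ R.level P (u * r)) : Butterfly cs u (u * r) := by
  obtain ⟨x, hx, hxu⟩ := h.exists_level_eq_zero u
  have hv := level_le (R := R) P (u * r)
  have hev := h.even_level_of_isReflectionIn (x := u) hr
  have hlt : R.level P u + 3 ≤ R.level P (u * r) := by
    by_contra hlt
    have : R.level P (u * r) = R.level P u + 2 := by omega
    rw [this, Nat.even_add, iff_true_right even_two] at hev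
    tauto
  set k := R.level P u
  have hA := fun j (hj : j ≤ _) => h.level_alternatingMul hx (j := j) hj
  have hB := fun j (hj : j ≤ _) => h.symm.level_alternatingMul hx (j := j) hj
  have hrm := h.mem_closure_of_isReflectionIn hr
  have hAm := IsBase.alternatingMul_mem s t hxu
  have hBm := IsBase.alternatingMul_mem t s (by rwa [Set.pair_comm])
  simp only [Set.pair_comm t s] at hBm
  have hstep : ∀ y z, u⁻¹ * y ∈ Subgroup.closure {s, t} → u⁻¹ * z ∈ Subgroup.closure {s, t} →
      (Even (R.level P y) ↔ ¬ Even (R.level P z)) → R.level P y < R.level P z →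
      BruhatStep cs y z := by
    intro y z hy hz
    refine h.bruhatStep_of_level_lt ?_
    have := mul_mem (inv_mem hy) hz
    rwa [mul_inv_rev, inv_inv, mul_assoc, mul_inv_cancel_left] at this
  have hum : u⁻¹ * u ∈ Subgroup.closure {s, t} := by simp [one_mem]
  have hvm : u⁻¹ * (u * r) ∈ Subgroup.closure {s, t} := by rwa [inv_mul_cancel_left]
  have hA1 := hA (k + 1) (by omega)
  have hA2 := hA (k + 2) (by omega)
  have hB1 := hB (k + 1) (by omega)
  have hB2 := hB (k + 2) (by omega)
  have e1 : Even (k + 1) ↔ ¬ Even k := Nat.even_add_one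
  have e2 : Even (k + 2) ↔ Even k := by simp [Nat.even_add]
  refine ⟨_, _, _, _, h.alternatingMul_ne hx (j := k) (by omega),
    h.alternatingMul_ne hx (j := k + 1) (by omega),
    hstep _ _ hum (hAm _) ?_ ?_, hstep _ _ hum (hBm _) ?_ ?_,
    hstep _ _ (hAm _) (hAm _) ?_ ?_, hstep _ _ (hAm _) (hBm _) ?_ ?_,
    hstep _ _ (hBm _) (hAm _) ?_ ?_, hstep _ _ (hBm _) (hBm _) ?_ ?_,
    hstep _ _ (hAm _) hvm ?_ ?_, hstep _ _ (hBm _) hvm ?_ ?_⟩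
  all_goals first | rw [hA1] | skip
  all_goals first | rw [hA2] | skip
  all_goals first | rw [hB1] | skip
  all_goals first | rw [hB2] | skip
  all_goals first | omega | skip
  all_goals tauto

end RootRep

namespace RootRep

variable {cs : CoxeterSystem M W} {V : Type*} [AddCommGroup V] [Module ℝ V] {R : RootRep cs V}

/-- A reflection that raises the length by at least two raises the number of inversions by at
least two in some plane. -/
theorem exists_level_add_two_le [Finite W] {u t : W} {β : V} (ht : R.IsRootOf t β)
    (hβ : 0 < R.height β) (hu : 0 < R.height (R.ρ u β))
    (hl : cs.length u + 2 ≤ cs.length (u * t)) :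
    ∃ γ ∈ R.posRoots, γ ≠ β ∧ R.level (Submodule.span ℝ {β, γ}) u + 2 ≤
      R.level (Submodule.span ℝ {β, γ}) (u * t) := by
  classical
  by_contra! hcon
  have hfin := fun x => finite_inversions (R := R) ⊤ x
  have hβm : β ∈ (hfin (u * t)).toFinset := by
    rw [Set.Finite.mem_toFinset]
    refine ⟨⟨⟨t, ht⟩, hβ⟩, trivial, ?_⟩
    rw [R.ρ_mul_apply, ht.apply_self, map_neg, map_neg]
    linarith
  have hβu : β ∉ (hfin u).toFinset := by
    rw [Set.Finite.mem_toFinset]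
    rintro ⟨-, -, h⟩
    linarith
  have hle : ((hfin (u * t)).toFinset.erase β).card ≤ (hfin u).toFinset.card := by
    let F := ((finite_posRoots (R := R)).toFinset.erase β).image
      fun γ => Submodule.span ℝ {β, γ}
    have hspan : ∀ γ δ, γ ∈ R.posRoots → δ ∈ R.posRoots → δ ≠ β →
        δ ∈ Submodule.span ℝ {β, γ} → Submodule.span ℝ {β, δ} = Submodule.span ℝ {β, γ} := by
      intro γ δ hγ hδ hne hmem
      refine le_antisymm (Submodule.span_le.2 ?_) (Submodule.span_le.2 ?_)
      · rintro _ (rfl | rfl)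
        · exact Submodule.subset_span (by simp)
        · exact hmem
      · rintro _ (rfl | rfl)
        · exact Submodule.subset_span (by simp)
        · exact mem_span_of_ne ⟨⟨t, ht⟩, hβ⟩ hδ hne hmem
    have hF : ∀ x, ∀ γ ∈ (hfin x).toFinset.erase β, Submodule.span ℝ {β, γ} ∈ F := by
      intro x γ hγ
      rw [Finset.mem_erase, Set.Finite.mem_toFinset] at hγ
      refine Finset.mem_image_of_mem _ ?_
      rw [Finset.mem_erase, Set.Finite.mem_toFinset]
      exact ⟨hγ.1, hγ.2.1⟩
    rw [← Finset.erase_eq_of_notMem hβu, Finset.card_eq_sum_card_fiberwise (hF (u * t)),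
      Finset.card_eq_sum_card_fiberwise (hF u)]
    refine Finset.sum_le_sum fun P hP => ?_
    obtain ⟨γ, hγ, rfl⟩ := Finset.mem_image.1 hP
    rw [Finset.mem_erase, Set.Finite.mem_toFinset] at hγ
    have hfib : ∀ x, ((hfin x).toFinset.erase β).filter
        (fun δ => Submodule.span ℝ {β, δ} = Submodule.span ℝ {β, γ}) =
        (finite_inversions (R := R) (Submodule.span ℝ {β, γ}) x).toFinset.erase β := by
      intro x
      ext δ
      simp only [Finset.mem_filter, Finset.mem_erase, Set.Finite.mem_toFinset]
      constructor
      · rintro ⟨⟨hne, h1, -, h2⟩, h3⟩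
        exact ⟨hne, h1, h3 ▸ Submodule.subset_span (by simp), h2⟩
      · rintro ⟨hne, h1, h2, h3⟩
        exact ⟨⟨hne, h1, trivial, h3⟩, hspan γ δ hγ.2 h1 hne h2⟩
    have hc := hcon γ hγ.2 hγ.1
    rw [level, level, Set.ncard_eq_toFinset_card _ (finite_inversions _ _),
      Set.ncard_eq_toFinset_card _ (finite_inversions _ _)] at hc
    rw [hfib, hfib, Finset.card_erase_of_mem, Finset.erase_eq_of_notMem]
    · omega
    · rw [Set.Finite.mem_toFinset]
      rintro ⟨-, -, h⟩
      linarith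
    · rw [Set.Finite.mem_toFinset]
      rw [Set.Finite.mem_toFinset] at hβm
      exact ⟨hβm.1, Submodule.subset_span (by simp), hβm.2.2⟩
  rw [Finset.card_erase_of_mem hβm, ← Set.ncard_eq_toFinset_card _ (hfin _),
    ← Set.ncard_eq_toFinset_card _ (hfin _)] at hle
  change R.level ⊤ _ - 1 ≤ R.level ⊤ _ at hle
  rw [R.level_top, R.level_top] at hle
  omega

theorem butterfly_of_bruhatStep [Finite W] (R : RootRep cs V) {u v : W} (h : BruhatStep cs u v)
    (hl : cs.length u + 2 ≤ cs.length v) : Butterfly cs u v := by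
  obtain ⟨t, β, ht, hβ, hu, rfl⟩ := R.bruhatStep_iff.1 h
  obtain ⟨γ, hγ, hne, hlev⟩ := exists_level_add_two_le ht hβ hu hl
  obtain ⟨s, s', α, β', hb⟩ := exists_isBase ⟨⟨t, ht⟩, hβ⟩ hγ hne
  exact hb.butterfly ⟨β, ht, Submodule.subset_span (by simp)⟩ hlev

theorem eq_of_form_eq_two [Finite W] {t₁ t₂ : W} {γ₁ γ₂ : V} (h₁ : R.IsRootOf t₁ γ₁)
    (h₂ : R.IsRootOf t₂ γ₂) (h : R.form γ₁ γ₂ = 2) : γ₁ = γ₂ := by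
  have h' : R.form γ₂ γ₁ = 2 := by rw [R.form_comm, h]
  have hδ : R.ρ (t₁ * t₂) (γ₁ - γ₂) = γ₁ - γ₂ := by
    rw [R.ρ_mul_apply, h₂.apply, h₁.apply]
    simp only [map_sub, map_smul, h, h', h₁.form_self, h₂.form_self, smul_eq_mul]
    module
  have hγ : R.ρ (t₁ * t₂) γ₁ = γ₁ + (2 : ℝ) • (γ₁ - γ₂) := by
    rw [R.ρ_mul_apply, h₂.apply, h₁.apply]
    simp only [map_sub, map_smul, h, h', h₁.form_self, smul_eq_mul]
    module
  have hpow : ∀ n : ℕ, R.ρ ((t₁ * t₂) ^ n) γ₁ = γ₁ + (2 * n : ℝ) • (γ₁ - γ₂) := by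
    intro n
    induction n with
    | zero => simp
    | succ n ih =>
      rw [pow_succ', R.ρ_mul_apply, ih, map_add, map_smul, hδ, hγ]
      push_cast
      module
  have h0 := hpow (orderOf (t₁ * t₂))
  rw [pow_orderOf_eq_one, map_one, Module.End.one_apply, left_eq_add, smul_eq_zero] at h0
  refine sub_eq_zero.1 (h0.resolve_left ?_)
  have := orderOf_pos (t₁ * t₂)
  positivity

theorem mem_of_mul_eq_mul [Finite W] {P : Submodule ℝ V} {t₁ t₂ t₃ t₄ : W} {γ₃ : V}
    (h₁ : R.IsReflectionIn P t₁) (h₂ : R.IsReflectionIn P t₂) (h₃ : R.IsRootOf t₃ γ₃)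
    (h₄ : cs.IsReflection t₄) (h : t₁ * t₂ = t₃ * t₄) (hne : t₃ ≠ t₄) : γ₃ ∈ P := by
  obtain ⟨γ₁, h₁, hP₁⟩ := h₁
  obtain ⟨γ₂, h₂, hP₂⟩ := h₂
  obtain ⟨γ₄, h₄, -⟩ := R.exists_isRootOf h₄
  have e1 : R.form γ₃ γ₄ ≠ 2 := fun he => hne <| by
    rw [eq_of_form_eq_two h₃ h₄ he] at h₃
    exact h₃.reflection_unique h₄
  have e2 : R.form γ₃ γ₄ ≠ -2 := fun he => hne <| by
    rw [eq_of_form_eq_two h₃ h₄.neg (by rw [map_neg, he, neg_neg])] at h₃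
    exact h₃.reflection_unique h₄.neg
  generalize he : R.form γ₃ γ₄ = e at e1 e2
  have he' : R.form γ₄ γ₃ = e := by rw [R.form_comm, he]
  have key : ∀ x, R.ρ (t₁ * t₂) x - x ∈ P := by
    intro x
    rw [R.ρ_mul_apply, h₂.apply, h₁.apply]
    convert P.neg_mem (P.add_mem (P.smul_mem (R.form γ₂ x) hP₂)
      (P.smul_mem (R.form γ₁ (x - R.form γ₂ x • γ₂)) hP₁)) using 1
    abel
  have h5 := key (γ₃ - (e / 2) • γ₄)
  have h6 : R.ρ (t₁ * t₂) (γ₃ - (e / 2) • γ₄) - (γ₃ - (e / 2) • γ₄) =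
      ((e - 2) * (e + 2) / 2) • γ₃ := by
    rw [h, R.ρ_mul_apply, h₄.apply, h₃.apply]
    simp only [map_sub, map_smul, he, he', h₄.form_self, h₃.form_self, smul_eq_mul]
    module
  rw [h6] at h5
  refine (P.smul_mem_iff ?_).1 h5
  have e3 : e - 2 ≠ 0 := sub_ne_zero.2 e1
  have e4 : e + 2 ≠ 0 := fun h => e2 (by linarith)
  exact div_ne_zero (mul_ne_zero e3 e4) two_ne_zero

end RootRep

theorem BruhatStep.isReflection {cs : CoxeterSystem M W} {a b : W} (h : BruhatStep cs a b) :
    cs.IsReflection (a⁻¹ * b) := by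
  obtain ⟨t, ht, rfl, -⟩ := h
  simpa [mul_assoc] using ht.conj a⁻¹

theorem BruhatStep.length_lt {cs : CoxeterSystem M W} {a b : W} (h : BruhatStep cs a b) :
    cs.length a < cs.length b := by
  obtain ⟨t, -, -, h⟩ := h
  exact h

theorem bruhatStep_of_isReflection {cs : CoxeterSystem M W} {a b : W}
    (h : cs.IsReflection (a⁻¹ * b)) (hl : cs.length a < cs.length b) : BruhatStep cs a b :=
  ⟨a * (a⁻¹ * b) * a⁻¹, h.conj a, by group, hl⟩

namespace RootRep

variable {V : Type*} [AddCommGroup V] [Module ℝ V]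

/-- In a crossing pair of squares of reflections, the second pair of reflections from the
bottom lies in the plane of the first. -/
theorem isReflectionIn_of_square [Finite W] {cs : CoxeterSystem M W} {R : RootRep cs V}
    {P : Submodule ℝ V} {u a b c : W} (hab : a ≠ b)
    (ha : R.IsReflectionIn P (u⁻¹ * a)) (hb : R.IsReflectionIn P (u⁻¹ * b))
    (hac : cs.IsReflection (a⁻¹ * c)) (hbc : cs.IsReflection (b⁻¹ * c)) :
    R.IsReflectionIn P (a⁻¹ * c) := by
  obtain ⟨γ, hγ, -⟩ := R.exists_isRootOf hac
  refine ⟨γ, hγ, mem_of_mul_eq_mul ha hb hγ hbc ?_ fun h => ?_⟩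
  · obtain ⟨_, ha, -⟩ := ha
    rw [← ha.inv_eq, ← hbc.inv]
    group
  · exact hab (inv_injective (mul_right_cancel h))

theorem bruhatStep_of_butterfly [Finite W] {cs : CoxeterSystem M W} (R : RootRep cs V) {u v : W}
    (h : Butterfly cs u v) : BruhatStep cs u v := by
  obtain ⟨a, b, c, d, hab, hcd, hua, hub, hac, had, hbc, hbd, hcv, hdv⟩ := h
  refine bruhatStep_of_isReflection ?_
    (hua.length_lt.trans (hac.length_lt.trans hcv.length_lt))
  obtain ⟨γ, hγ, hγpos⟩ := R.exists_isRootOf hua.isReflection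
  obtain ⟨δ, hδ, hδpos⟩ := R.exists_isRootOf hub.isReflection
  have hne : δ ≠ γ := by
    rintro rfl
    exact hab (mul_left_cancel (hγ.reflection_unique hδ))
  obtain ⟨s, t, α, β, hbase⟩ := exists_isBase ⟨⟨_, hγ⟩, hγpos⟩ ⟨⟨_, hδ⟩, hδpos⟩ hne
  set P := Submodule.span ℝ {γ, δ}
  have h1 : R.IsReflectionIn P (u⁻¹ * a) := ⟨γ, hγ, Submodule.subset_span (by simp)⟩
  have h2 : R.IsReflectionIn P (u⁻¹ * b) := ⟨δ, hδ, Submodule.subset_span (by simp)⟩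
  have h3 := isReflectionIn_of_square hab h1 h2 hac.isReflection hbc.isReflection
  have h4 := isReflectionIn_of_square hab h1 h2 had.isReflection hbd.isReflection
  have h5 := isReflectionIn_of_square hcd h3 h4 hcv.isReflection hdv.isReflection
  obtain ⟨_, h, -⟩ := hbase.isReflectionIn_mul_mul h1 h3 h5
  simpa [mul_assoc] using h.isReflection

end RootRep

section Transfer

variable {cs : CoxeterSystem M W} {V : Type*} [AddCommGroup V] [Module ℝ V]

theorem BruhatStep.le {a b : W} (h : BruhatStep cs a b) : BruhatLE cs a b :=
  Relation.ReflTransGen.single h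

theorem BruhatStep.ne {a b : W} (h : BruhatStep cs a b) : a ≠ b := by
  rintro rfl
  exact h.length_lt.false

theorem BruhatLE.one_le (x : W) : BruhatLE cs 1 x := by
  induction hn : cs.length x using Nat.strong_induction_on generalizing x with
  | _ n ih =>
    by_cases hx : x = 1
    · rw [hx]
      exact Relation.ReflTransGen.refl
    · obtain ⟨i, hi⟩ := cs.exists_leftDescent_of_ne_one hx
      have hi' : cs.length (cs.simple i * x) < cs.length x := hi
      exact (ih _ (hn ▸ hi') _ rfl).tail
        ⟨cs.simple i, cs.isReflection_simple i, by simp, hi'⟩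

namespace RootRep

/-- Every nontrivial relation in the Bruhat order starts with a step of length one. -/
theorem exists_bruhatStep_of_le [Finite W] (R : RootRep cs V) {a b : W} (h : BruhatLE cs a b)
    (hne : a ≠ b) : ∃ c, BruhatStep cs a c ∧ BruhatLE cs c b ∧ cs.length c = cs.length a + 1 := by
  rcases Relation.ReflTransGen.cases_head h with h | ⟨c, hac, hcb⟩
  · exact absurd h hne
  induction hn : cs.length c using Nat.strong_induction_on generalizing c with
  | _ n ih =>
    subst hn
    by_cases hc : cs.length c = cs.length a + 1
    · exact ⟨c, hac, hcb, hc⟩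
    · have hlt := hac.length_lt
      obtain ⟨d, -, e, -, -, -, hd, -, hde, -, -, -, he, -⟩ :=
        R.butterfly_of_bruhatStep hac (by omega)
      exact ih _ (hde.length_lt.trans he.length_lt) d hd (hde.le.trans (he.le.trans hcb)) rfl

theorem covBy_iff [Finite W] (R : RootRep cs V) {u w : W} {a b : BruhatInterval cs u w} :
    a ⋖ b ↔ BruhatStep cs a.1 b.1 ∧ cs.length b.1 = cs.length a.1 + 1 := by
  constructor
  · intro h
    obtain ⟨c, hac, hcb, hc⟩ := R.exists_bruhatStep_of_le (show BruhatLE cs a.1 b.1 from h.1.le)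
      fun he => h.1.ne (Subtype.ext he)
    let c' : BruhatInterval cs u w := ⟨c, a.2.1.trans hac.le, hcb.trans b.2.2⟩
    have hc' : a < c' := lt_of_le_of_ne (show BruhatLE cs a.1 c from hac.le)
      fun he => hac.ne (congrArg Subtype.val he)
    have : c = b.1 := by
      by_contra hne
      exact h.2 hc' (lt_of_le_of_ne (show BruhatLE cs c b.1 from hcb)
        fun he => hne (congrArg Subtype.val he))
    exact this ▸ ⟨hac, hc⟩
  · rintro ⟨h, hl⟩
    have key : ∀ {p q : BruhatInterval cs u w}, p < q → cs.length p.1 < cs.length q.1 :=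
      fun {p q} hpq => BruhatLE.length_lt (show BruhatLE cs p.1 q.1 from hpq.le)
        fun he => hpq.ne (Subtype.ext he)
    refine ⟨lt_of_le_of_ne (show BruhatLE cs a.1 b.1 from h.le)
      fun he => h.ne (congrArg Subtype.val he), fun c hac hcb => ?_⟩
    have := key hac
    have := key hcb
    omega

/-- The number of Bruhat steps down from `x` is the length of `x`. -/
theorem card_bruhatStep [Finite W] (R : RootRep cs V) (x : W) :
    Nat.card {z : W // BruhatStep cs z x} = cs.length x := by
  rw [← R.level_top, level, ← Nat.card_coe_set_eq, eq_comm]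
  have hroot : ∀ γ : R.inversions ⊤ x, ∃ t, R.IsRootOf t γ.1 := fun γ => γ.2.1.1
  choose t ht using hroot
  have hstep : ∀ γ, BruhatStep cs (x * t γ) x := fun γ => by
    refine R.bruhatStep_iff.2 ⟨t γ, γ.1, ht γ, γ.2.1.2, ?_, by simp [mul_assoc, (ht γ).mul_self]⟩
    rw [R.ρ_mul_apply, (ht γ).apply_self, map_neg, map_neg]
    linarith [γ.2.2.2]
  refine Nat.card_congr (Equiv.ofBijective (fun γ => ⟨x * t γ, hstep γ⟩) ⟨fun γ δ h => ?_, ?_⟩)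
  · have h1 : t γ = t δ := mul_left_cancel (congrArg Subtype.val h)
    have h2 := ht γ
    rw [h1] at h2
    rcases h2.eq_or_eq_neg_of_reflection (ht δ) with h3 | h3
    · exact Subtype.ext h3.symm
    · have h4 := γ.2.1.2
      have h5 := δ.2.1.2
      rw [h3, map_neg] at h5
      linarith
  · rintro ⟨z, hz⟩
    obtain ⟨s, γ, hs, hγ, hzγ, rfl⟩ := R.bruhatStep_iff.1 hz
    have hmem : γ ∈ R.inversions ⊤ (z * s) := by
      refine ⟨⟨⟨s, hs⟩, hγ⟩, trivial, ?_⟩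
      rw [R.ρ_mul_apply, hs.apply_self, map_neg, map_neg]
      linarith
    refine ⟨⟨γ, hmem⟩, Subtype.ext ?_⟩
    dsimp only
    rw [(ht ⟨γ, hmem⟩).reflection_unique hs, mul_assoc, hs.mul_self, mul_one]

end RootRep

variable [Finite W] {B' W' : Type*} [Group W'] [Finite W'] {M' : CoxeterMatrix B'}
  {cs' : CoxeterSystem M' W'} {V' : Type*} [AddCommGroup V'] [Module ℝ V'] {u w : W} {u' w' : W'}

/-- An anti-isomorphism of Bruhat intervals reverses Bruhat steps. -/
theorem BruhatStep.map_antitone (R : RootRep cs V) (R' : RootRep cs' V')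
    (f : (BruhatInterval cs u w)ᵒᵈ ≃o BruhatInterval cs' u' w') {a b : BruhatInterval cs u w}
    (h : BruhatStep cs a.1 b.1) :
    BruhatStep cs' (f (OrderDual.toDual b)).1 (f (OrderDual.toDual a)).1 := by
  induction hn : cs.length b.1 - cs.length a.1 using Nat.strong_induction_on
    generalizing a b with
  | _ n ih =>
    have hlt := h.length_lt
    by_cases hl : cs.length b.1 = cs.length a.1 + 1
    · have hab : a ⋖ b := R.covBy_iff.2 ⟨h, hl⟩
      exact (R'.covBy_iff.1 ((apply_covBy_apply_iff f).2 (toDual_covBy_toDual_iff.2 hab))).1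
    · obtain ⟨p, q, r, s, hpq, hrs, h1, h2, h3, h4, h5, h6, h7, h8⟩ :=
        R.butterfly_of_bruhatStep h (by omega)
      let p' : BruhatInterval cs u w :=
        ⟨p, a.2.1.trans h1.le, h3.le.trans (h7.le.trans b.2.2)⟩
      let q' : BruhatInterval cs u w :=
        ⟨q, a.2.1.trans h2.le, h5.le.trans (h7.le.trans b.2.2)⟩
      let r' : BruhatInterval cs u w := ⟨r, p'.2.1.trans h3.le, h7.le.trans b.2.2⟩
      let s' : BruhatInterval cs u w := ⟨s, p'.2.1.trans h4.le, h8.le.trans b.2.2⟩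
      have l1 := h1.length_lt
      have l2 := h2.length_lt
      have l3 := h3.length_lt
      have l4 := h4.length_lt
      have l5 := h5.length_lt
      have l6 := h6.length_lt
      have l7 := h7.length_lt
      have l8 := h8.length_lt
      have hinj : ∀ {y z : BruhatInterval cs u w}, y.1 ≠ z.1 →
          (f (OrderDual.toDual y)).1 ≠ (f (OrderDual.toDual z)).1 := fun hyz he =>
        hyz (congrArg Subtype.val (OrderDual.toDual.injective (f.injective (Subtype.ext he))))
      exact R'.bruhatStep_of_butterfly ⟨_, _, _, _, hinj (y := r') (z := s') hrs,
        hinj (y := p') (z := q') hpq,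
        ih _ (by lia) (a := r') (b := b) h7 rfl,
        ih _ (by lia) (a := s') (b := b) h8 rfl,
        ih _ (by lia) (a := p') (b := r') h3 rfl,
        ih _ (by lia) (a := q') (b := r') h5 rfl,
        ih _ (by lia) (a := p') (b := s') h4 rfl,
        ih _ (by lia) (a := q') (b := s') h6 rfl,
        ih _ (by lia) (a := a) (b := p') h1 rfl,
        ih _ (by lia) (a := a) (b := q') h2 rfl⟩

theorem bruhatStep_map_iff (R : RootRep cs V) (R' : RootRep cs' V')
    (f : (BruhatInterval cs u w)ᵒᵈ ≃o BruhatInterval cs' u' w') {a b : BruhatInterval cs u w} :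
    BruhatStep cs' (f (OrderDual.toDual b)).1 (f (OrderDual.toDual a)).1 ↔
      BruhatStep cs a.1 b.1 := by
  refine ⟨fun h => ?_, BruhatStep.map_antitone R R' f⟩
  have := BruhatStep.map_antitone R' R (f.dual.symm.trans (OrderIso.dualDual _).symm) h
  simpa using this

/-- An anti-isomorphism onto a lower Bruhat interval turns lengths into colengths. -/
theorem length_add_length_map (R : RootRep cs V) (R' : RootRep cs' V')
    (f : (BruhatInterval cs u w)ᵒᵈ ≃o BruhatInterval cs' 1 w') (y : BruhatInterval cs u w) :
    cs'.length (f (OrderDual.toDual y)).1 + cs.length y.1 = cs.length w := by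
  induction hn : cs.length w - cs.length y.1 using Nat.strong_induction_on generalizing y with
  | _ n ih =>
    by_cases hy : y.1 = w
    · obtain ⟨z, hz⟩ := f.surjective
        ⟨1, Relation.ReflTransGen.refl, BruhatLE.one_le w'⟩
      have h1 : f (OrderDual.toDual y) ≤ f z := by
        refine f.le_iff_le.2 (show BruhatLE cs (OrderDual.ofDual z).1 y.1 from ?_)
        rw [hy]
        exact (OrderDual.ofDual z).2.2
      rw [hz] at h1
      have h2 := BruhatLE.length_le h1
      rw [cs'.length_one] at h2
      rw [hy]
      lia
    · obtain ⟨c, hyc, hcw, hc⟩ := R.exists_bruhatStep_of_le y.2.2 hy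
      let c' : BruhatInterval cs u w := ⟨c, y.2.1.trans hyc.le, hcw⟩
      have hcov : y ⋖ c' := R.covBy_iff.2 ⟨hyc, hc⟩
      have h1 := (R'.covBy_iff.1
        ((apply_covBy_apply_iff f).2 (toDual_covBy_toDual_iff.2 hcov))).2
      have h2 := ih _ (by have := BruhatLE.length_le hcw; dsimp only [c']; omega) c' rfl
      dsimp only [c'] at h1 h2
      omega

end Transfer

/-- If the dual of a Bruhat interval `[u,w]` in a Weyl group is isomorphic, as
a poset, to a lower Bruhat interval `[e,x]` in a Weyl group `W'` (possibly of a different type),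
then `[u,w]` is rationally smooth. -/
theorem dual_iso_lower_rationally_smooth {B W : Type*} [Group W] [Finite W] {M : CoxeterMatrix B}
    (cs : CoxeterSystem M W)
    (hcrys : ∀ i j : B, i ≠ j → M i j ∈ ({2, 3, 4, 6} : Set ℕ))
    {B' W' : Type*} [Group W'] [Finite W'] {M' : CoxeterMatrix B'}
    (cs' : CoxeterSystem M' W')
    (hcrys' : ∀ i j : B', i ≠ j → M' i j ∈ ({2, 3, 4, 6} : Set ℕ))
    (u w : W) (huw : BruhatLE cs u w) (hne : u ≠ w)
    (x : W') (hx : x ≠ 1)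
    (iso : (BruhatInterval cs u w)ᵒᵈ ≃o BruhatInterval cs' 1 x) :
    RationallySmooth cs u w := by
  let R := geomRootRep cs hcrys
  let R' := geomRootRep cs' hcrys'
  intro y huy hyw
  let y' : BruhatInterval cs u w := ⟨y, huy, hyw⟩
  have hlen := length_add_length_map R R' iso y'
  suffices h : bruhatDeg cs y w y = cs'.length (iso (OrderDual.toDual y')).1 by
    rw [h, ← hlen, Nat.add_sub_cancel]
  rw [← R'.card_bruhatStep]
  have hstep : ∀ z, BruhatLE cs y z ∧ cs.IsReflection (y⁻¹ * z) ↔ BruhatStep cs y z := by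
    refine fun z => ⟨fun ⟨hyz, hz⟩ => bruhatStep_of_isReflection hz (hyz.length_lt ?_),
      fun h => ⟨h.le, h.isReflection⟩⟩
    rintro rfl
    simpa using hz.odd_length
  refine Nat.card_congr (Equiv.ofBijective (fun z =>
    ⟨(iso (OrderDual.toDual ⟨z.1, huy.trans z.2.1.1, z.2.1.2⟩)).1,
      BruhatStep.map_antitone R R' iso (a := y') ((hstep _).1 ⟨z.2.1.1, z.2.2⟩)⟩)
    ⟨fun z₁ z₂ h => ?_, ?_⟩)
  · have h0 : (iso (OrderDual.toDual ⟨z₁.1, huy.trans z₁.2.1.1, z₁.2.1.2⟩)).1 =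
        (iso (OrderDual.toDual ⟨z₂.1, huy.trans z₂.2.1.1, z₂.2.1.2⟩)).1 :=
      Subtype.mk.inj h
    have h1 := iso.injective (Subtype.ext h0)
    exact Subtype.ext (congrArg (fun z => (OrderDual.ofDual z).1) h1)
  · rintro ⟨z, hz⟩
    obtain ⟨v, hv⟩ := iso.surjective
      ⟨z, BruhatLE.one_le z, hz.le.trans (iso (OrderDual.toDual y')).2.2⟩
    have hyv : BruhatStep cs y (OrderDual.ofDual v).1 := by
      refine (bruhatStep_map_iff R R' iso (a := y')).1 ?_
      rw [OrderDual.toDual_ofDual, hv]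
      exact hz
    have h2 := (hstep _).2 hyv
    refine ⟨⟨_, ⟨h2.1, (OrderDual.ofDual v).2.2⟩, h2.2⟩, Subtype.ext ?_⟩
    simp [hv]

end Paper
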